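/- arXiv:2004.04553 — 4 statements merged into one kernel-verified Lean document; each statement's English description precedes it below -/
import Mathlib

section
/- For every real p > 1, the sum S₁(p) := 4p Σ_{(m,n)∈ℤ²∖{0}} [(p+1)(n²−m²)² − 2m⁴ − 2m²n²]/(m²+n²)^{p+2} converges absolutely and S₁(p) > 0. -/
noncomputable section

/-- Alternating-charge inverse-power-law energy of the rectangular lattice
`V^{1/2}(yℤ × y⁻¹ℤ)`:
`G_V(y) = Σ_{(m,n)≠0} (V(y²m² + y⁻²n²))^{-p} + Σ_{(m,n)≠0} (-1)^{m+n}(V(y²m² + y⁻²n²))^{-q}`. -/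
def G (p q V y : ℝ) : ℝ :=
  (∑' x : {x : ℤ × ℤ // x ≠ 0},
      (V * (y ^ 2 * (x.1.1 : ℝ) ^ 2 + (y⁻¹) ^ 2 * (x.1.2 : ℝ) ^ 2)) ^ (-p))
  + ∑' x : {x : ℤ × ℤ // x ≠ 0},
      (-1 : ℝ) ^ (x.1.1 + x.1.2) *
        (V * (y ^ 2 * (x.1.1 : ℝ) ^ 2 + (y⁻¹) ^ 2 * (x.1.2 : ℝ) ^ 2)) ^ (-q)

/-- `S₁(p) = 4p Σ_{(m,n)≠0} [(p+1)(n²-m²)² - 2m⁴ - 2m²n²]/(m²+n²)^{p+2}`. -/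
def S1 (p : ℝ) : ℝ :=
  4 * p * ∑' x : {x : ℤ × ℤ // x ≠ 0},
    ((p + 1) * ((x.1.2 : ℝ) ^ 2 - (x.1.1 : ℝ) ^ 2) ^ 2
        - 2 * (x.1.1 : ℝ) ^ 4 - 2 * (x.1.1 : ℝ) ^ 2 * (x.1.2 : ℝ) ^ 2)
      / ((x.1.1 : ℝ) ^ 2 + (x.1.2 : ℝ) ^ 2) ^ (p + 2)

/-- `S₂(q) = 4q Σ_{(m,n)≠0} (-1)^{m+n}[(q+1)(n²-m²)² - 2m⁴ - 2m²n²]/(m²+n²)^{q+2}`. -/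
def S2 (q : ℝ) : ℝ :=
  4 * q * ∑' x : {x : ℤ × ℤ // x ≠ 0},
    (-1 : ℝ) ^ (x.1.1 + x.1.2) *
      ((q + 1) * ((x.1.2 : ℝ) ^ 2 - (x.1.1 : ℝ) ^ 2) ^ 2
          - 2 * (x.1.1 : ℝ) ^ 4 - 2 * (x.1.1 : ℝ) ^ 2 * (x.1.2 : ℝ) ^ 2)
      / ((x.1.1 : ℝ) ^ 2 + (x.1.2 : ℝ) ^ 2) ^ (q + 2)

/-- The moments `∑ n^{2k} e^{-π n² t}` of the Gaussian on `ℤ`. -/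
def thetaMoment (k : ℕ) (t : ℝ) : ℝ :=
  ∑' n : ℤ, ((n : ℝ) ^ 2) ^ k * Real.exp (-Real.pi * n ^ 2 * t)

theorem summable_thetaMoment (k : ℕ) {t : ℝ} (ht : 0 < t) :
    Summable fun n : ℤ => ((n : ℝ) ^ 2) ^ k * Real.exp (-Real.pi * n ^ 2 * t) := by
  refine (summable_pow_mul_jacobiTheta₂_term_bound 0 ht (2 * k)).congr fun n => ?_
  rw [pow_mul, Int.cast_abs, sq_abs]
  ring_nf

theorem thetaMoment_pos (k : ℕ) {t : ℝ} (ht : 0 < t) : 0 < thetaMoment k t :=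
  (summable_thetaMoment k ht).tsum_pos (fun n => by positivity) 1 (by simp [Real.exp_pos])

theorem hasDerivAt_thetaMoment (k : ℕ) {t : ℝ} (ht : 0 < t) :
    HasDerivAt (thetaMoment k) (-Real.pi * thetaMoment (k + 1) t) t := by
  have key := hasDerivAt_tsum_of_isPreconnected (t := Set.Ioi (t / 2)) (y := t) (y₀ := t)
    (g := fun (n : ℤ) (s : ℝ) => ((n : ℝ) ^ 2) ^ k * Real.exp (-Real.pi * n ^ 2 * s))
    (g' := fun (n : ℤ) (s : ℝ) =>
      -Real.pi * (((n : ℝ) ^ 2) ^ (k + 1) * Real.exp (-Real.pi * n ^ 2 * s)))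
    ((summable_thetaMoment (k + 1) (half_pos ht)).mul_left Real.pi) isOpen_Ioi isPreconnected_Ioi
    (fun n s _ => ?_) (fun n s hs => ?_) (half_lt_self ht) (summable_thetaMoment k ht)
    (half_lt_self ht)
  · rw [tsum_mul_left] at key
    exact key
  · convert! (((hasDerivAt_id s).const_mul (-Real.pi * (n : ℝ) ^ 2)).exp).const_mul
      (((n : ℝ) ^ 2) ^ k) using 1
    simp only [id]
    ring
  · rw [norm_mul, norm_neg, Real.norm_of_nonneg Real.pi_pos.le, Real.norm_of_nonneg (by positivity)]
    have hs' : t / 2 ≤ s := le_of_lt hs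
    have : -Real.pi * (n : ℝ) ^ 2 * s ≤ -Real.pi * (n : ℝ) ^ 2 * (t / 2) := by
      have : 0 ≤ Real.pi * (n : ℝ) ^ 2 := by positivity
      nlinarith
    gcongr

theorem thetaMoment_zero_inv {t : ℝ} (ht : 0 < t) :
    (thetaMoment 0 t ^ 2)⁻¹ = t * (thetaMoment 0 t⁻¹ ^ 2)⁻¹ := by
  have h := Real.tsum_exp_neg_mul_int_sq ht
  have h₁ : thetaMoment 0 t = 1 / t ^ (1 / 2 : ℝ) * thetaMoment 0 t⁻¹ := by
    simp only [thetaMoment, pow_zero, one_mul]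
    convert! h using 4
    · ring_nf
    · ring_nf
  rw [h₁, ← Real.sqrt_eq_rpow, mul_pow, div_pow, Real.sq_sqrt ht.le]
  simp [mul_comm]

theorem hasDerivAt_thetaMoment_zero_inv_sq {t : ℝ} (ht : 0 < t) :
    HasDerivAt (fun s => (thetaMoment 0 s ^ 2)⁻¹)
      (2 * Real.pi * thetaMoment 1 t / thetaMoment 0 t ^ 3) t := by
  have h := thetaMoment_pos 0 ht
  convert! ((hasDerivAt_thetaMoment 0 ht).pow 2).inv (pow_pos h 2).ne' using 1
  simp only [Pi.pow_apply]
  field_simp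
  ring

theorem hasDerivAt_deriv_thetaMoment_zero_inv_sq {t : ℝ} (ht : 0 < t) :
    HasDerivAt (fun s => 2 * Real.pi * thetaMoment 1 s / thetaMoment 0 s ^ 3)
      (-2 * Real.pi ^ 2 * (thetaMoment 2 t * thetaMoment 0 t - 3 * thetaMoment 1 t ^ 2)
        / thetaMoment 0 t ^ 4) t := by
  have h := thetaMoment_pos 0 ht
  convert! ((hasDerivAt_thetaMoment 1 ht).const_mul (2 * Real.pi)).div
    ((hasDerivAt_thetaMoment 0 ht).pow 3) (by simp only [Pi.pow_apply]; positivity) using 1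
  simp only [Pi.pow_apply]
  field_simp
  ring

theorem deriv_thetaMoment_zero_inv_sq_inv {t : ℝ} (ht : 0 < t) :
    2 * Real.pi * thetaMoment 1 t / thetaMoment 0 t ^ 3 =
      (thetaMoment 0 t⁻¹ ^ 2)⁻¹ -
        2 * Real.pi * thetaMoment 1 t⁻¹ / thetaMoment 0 t⁻¹ ^ 3 * t⁻¹ := by
  have h₁ := ((hasDerivAt_id t).mul
    ((hasDerivAt_thetaMoment_zero_inv_sq (inv_pos.2 ht)).comp t (hasDerivAt_inv ht.ne')))
  have h₂ := h₁.congr_of_eventuallyEq (f₁ := fun s => (thetaMoment 0 s ^ 2)⁻¹) <| by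
    filter_upwards [lt_mem_nhds ht] with s hs
    exact thetaMoment_zero_inv hs
  rw [(hasDerivAt_thetaMoment_zero_inv_sq ht).unique h₂]
  simp only [id, Function.comp]
  field_simp
  ring

/-- The second derivative of `t ↦ (∑ e^{-π n² t})⁻²` transforms with weight `3` under `t ↦ 1/t`. -/
theorem thetaMoment_discr_inv {t : ℝ} (ht : 0 < t) :
    (thetaMoment 2 t * thetaMoment 0 t - 3 * thetaMoment 1 t ^ 2) / thetaMoment 0 t ^ 4 =
      (thetaMoment 2 t⁻¹ * thetaMoment 0 t⁻¹ - 3 * thetaMoment 1 t⁻¹ ^ 2)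
        / thetaMoment 0 t⁻¹ ^ 4 * t⁻¹ ^ 3 := by
  have hi := hasDerivAt_inv ht.ne'
  have h₁ := ((hasDerivAt_thetaMoment_zero_inv_sq (inv_pos.2 ht)).comp t hi).sub
    (((hasDerivAt_deriv_thetaMoment_zero_inv_sq (inv_pos.2 ht)).comp t hi).mul hi)
  have h₂ := h₁.congr_of_eventuallyEq
    (f₁ := fun s => 2 * Real.pi * thetaMoment 1 s / thetaMoment 0 s ^ 3) <| by
    filter_upwards [lt_mem_nhds ht] with s hs
    exact deriv_thetaMoment_zero_inv_sq_inv hs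
  have h₃ := (hasDerivAt_deriv_thetaMoment_zero_inv_sq ht).unique h₂
  simp only [Function.comp] at h₃
  have hp : (-2 * Real.pi ^ 2) ≠ 0 := by have := Real.pi_pos; simp [this.ne']
  apply mul_left_cancel₀ hp
  rw [← mul_div_assoc, h₃]
  field_simp
  ring

theorem one_le_thetaMoment_zero {t : ℝ} (ht : 0 < t) : 1 ≤ thetaMoment 0 t := by
  simpa [thetaMoment] using (summable_thetaMoment 0 ht).le_tsum 0 fun n _ => by positivity

theorem thetaMoment_one_le_two {t : ℝ} (ht : 0 < t) : thetaMoment 1 t ≤ thetaMoment 2 t := by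
  refine (summable_thetaMoment 1 ht).tsum_le_tsum (fun n => ?_) (summable_thetaMoment 2 ht)
  gcongr ?_ * _
  have : n ^ 2 ≤ (n ^ 2) ^ 2 := by
    rcases eq_or_ne n 0 with rfl | hn
    · simp
    · nlinarith [Int.one_le_abs hn, sq_abs n, pow_pos (abs_pos.2 hn) 2]
  rw [pow_one]
  exact_mod_cast this

theorem natCast_sq_mul_exp_le {t : ℝ} (ht : 1 ≤ t) (n : ℕ) :
    ((n : ℝ) + 1) ^ 2 * Real.exp (-Real.pi * ((n : ℝ) + 1) ^ 2 * t) ≤ 1 / 12 * (1 / 2) ^ n := by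
  set x : ℝ := (n : ℝ) + 1 with hx
  have hx1 : 1 ≤ x := by simp [hx]
  have h₁ : x ^ 2 ≤ Real.exp (x ^ 2 - 1) := by linarith [Real.add_one_le_exp (x ^ 2 - 1)]
  have h₂ : -Real.pi * x ^ 2 * t ≤ -3 * x ^ 2 := by
    have : 3 * 1 ≤ Real.pi * t := mul_le_mul Real.pi_gt_three.le ht (by norm_num) Real.pi_pos.le
    nlinarith [sq_nonneg x]
  have he : Real.exp (-1) ≤ 2 / 5 := by linarith [Real.exp_neg_one_lt_d9]
  calc x ^ 2 * Real.exp (-Real.pi * x ^ 2 * t)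
      ≤ Real.exp (x ^ 2 - 1) * Real.exp (-3 * x ^ 2) := by gcongr
    _ = Real.exp (-1 - 2 * x ^ 2) := by rw [← Real.exp_add]; ring_nf
    _ ≤ Real.exp (((3 + n : ℕ) : ℝ) * (-1)) := by
        apply Real.exp_le_exp.2
        push_cast
        nlinarith
    _ = Real.exp (-1) ^ 3 * Real.exp (-1) ^ n := by rw [Real.exp_nat_mul, pow_add]
    _ ≤ (2 / 5) ^ 3 * (2 / 5) ^ n := by gcongr
    _ ≤ 1 / 12 * (1 / 2) ^ n := 
        mul_le_mul (by norm_num) (pow_le_pow_left₀ (by norm_num) (by norm_num) n)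
          (by positivity) (by norm_num)

theorem thetaMoment_one_le {t : ℝ} (ht : 1 ≤ t) : thetaMoment 1 t ≤ 1 / 3 := by
  have hg : HasSum (fun n : ℕ => (1 / 12 : ℝ) * (1 / 2) ^ n) (1 / 6) := by
    convert! hasSum_geometric_two.mul_left (1 / 12 : ℝ) using 1
    norm_num
  have hle := natCast_sq_mul_exp_le ht
  have hs : Summable fun n : ℕ =>
      ((n : ℝ) + 1) ^ 2 * Real.exp (-Real.pi * ((n : ℝ) + 1) ^ 2 * t) :=
    hg.summable.of_nonneg_of_le (fun n => by positivity) hle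
  have hb := hasSum_le hle hs.hasSum hg
  have h := HasSum.of_add_one_of_neg_add_one
    (f := fun n : ℤ => ((n : ℝ) ^ 2) ^ 1 * Real.exp (-Real.pi * n ^ 2 * t))
    (m := ∑' n : ℕ, ((n : ℝ) + 1) ^ 2 * Real.exp (-Real.pi * ((n : ℝ) + 1) ^ 2 * t))
    (m' := ∑' n : ℕ, ((n : ℝ) + 1) ^ 2 * Real.exp (-Real.pi * ((n : ℝ) + 1) ^ 2 * t))
    (by convert! hs.hasSum using 2; push_cast; ring_nf)
    (by convert! hs.hasSum using 2; push_cast; ring_nf)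
  rw [thetaMoment, h.tsum_eq, Int.cast_zero]
  linarith

theorem thetaMoment_discr_nonneg_of_one_le {t : ℝ} (ht : 1 ≤ t) :
    0 ≤ thetaMoment 2 t * thetaMoment 0 t - 3 * thetaMoment 1 t ^ 2 := by
  have ht0 : 0 < t := by linarith
  have h0 := one_le_thetaMoment_zero ht0
  have h1 := thetaMoment_one_le ht
  have h2 := thetaMoment_one_le_two ht0
  have hp := thetaMoment_pos 1 ht0
  nlinarith

/-- The function `t ↦ (∑ e^{-π n² t})⁻²` is concave, expressed through its second derivative. -/
theorem thetaMoment_discr_nonneg {t : ℝ} (ht : 0 < t) :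
    0 ≤ thetaMoment 2 t * thetaMoment 0 t - 3 * thetaMoment 1 t ^ 2 := by
  rcases le_total 1 t with h | h
  · exact thetaMoment_discr_nonneg_of_one_le h
  · have h₁ := thetaMoment_discr_nonneg_of_one_le (one_le_inv_iff₀.2 ⟨ht, h⟩)
    have h₂ := thetaMoment_discr_inv ht
    have h₃ := thetaMoment_pos 0 ht
    have h₄ := thetaMoment_pos 0 (inv_pos.2 ht)
    have h₅ : 0 ≤ (thetaMoment 2 t * thetaMoment 0 t - 3 * thetaMoment 1 t ^ 2)
        / thetaMoment 0 t ^ 4 := by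
      rw [h₂]
      positivity
    rwa [le_div_iff₀ (by positivity), zero_mul] at h₅

/-- A Dirichlet series whose associated exponential series is nonnegative is nonnegative. -/
theorem tsum_div_rpow_nonneg {ι : Type*} [Countable ι] {a q : ι → ℝ} {F : ℝ → ℝ} {s : ℝ}
    (hq : ∀ i, a i = 0 ∨ 0 < q i) (hs : 0 < s)
    (hF : ∀ t : ℝ, 0 < t → HasSum (fun i => a i * Real.exp (-Real.pi * q i * t)) (F t))
    (hF0 : ∀ t : ℝ, 0 < t → 0 ≤ F t) (hsum : Summable fun i => a i / q i ^ s) :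
    0 ≤ ∑' i, a i / q i ^ s := by
  have key := hasSum_mellin_pi_mul (a := fun i => (a i : ℂ)) (q := q) (F := fun t => (F t : ℂ))
    (s := (s : ℂ)) (fun i => by simpa using hq i) (by simpa using hs)
    (fun t ht => by exact_mod_cast Complex.hasSum_ofReal.2 (hF t ht)) (by
      refine hsum.abs.congr fun i => ?_
      rcases hq i with h | h
      · simp [h]
      · simp [abs_div, abs_of_pos (Real.rpow_pos_of_pos h s)])
  have hm : mellin (fun t => (F t : ℂ)) s =
      ((∫ t : ℝ in Set.Ioi 0, t ^ (s - 1) * F t : ℝ) : ℂ) := by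
    rw [mellin, ← integral_complex_ofReal]
    refine MeasureTheory.setIntegral_congr_fun measurableSet_Ioi fun t ht => ?_
    simp [Complex.ofReal_cpow (le_of_lt ht)]
  have hr : HasSum (fun i => Real.pi ^ (-s) * Real.Gamma s * (a i / q i ^ s))
      (∫ t : ℝ in Set.Ioi 0, t ^ (s - 1) * F t) := by
    rw [← Complex.hasSum_ofReal, ← hm]
    convert! key using 2 with i
    rcases hq i with h | h
    · simp [h]
    · push_cast
      rw [Complex.ofReal_cpow Real.pi_pos.le, Complex.ofReal_cpow h.le, Complex.Gamma_ofReal]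
      push_cast
      ring
  have hI : 0 ≤ ∫ t : ℝ in Set.Ioi 0, t ^ (s - 1) * F t :=
    MeasureTheory.setIntegral_nonneg measurableSet_Ioi fun t ht =>
      mul_nonneg (Real.rpow_nonneg (le_of_lt ht) _) (hF0 t ht)
  rw [← hr.tsum_eq, tsum_mul_left] at hI
  have := Real.Gamma_pos_of_pos hs
  have := Real.pi_pos
  exact nonneg_of_mul_nonneg_right hI (by positivity)

theorem summable_div_lattice_rpow {f : ℤ × ℤ → ℝ} {p C : ℝ} (hp : 1 < p)
    (hf : ∀ x, |f x| ≤ C * ((x.1 : ℝ) ^ 2 + (x.2 : ℝ) ^ 2) ^ 2) :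
    Summable fun x : ℤ × ℤ => f x / ((x.1 : ℝ) ^ 2 + (x.2 : ℝ) ^ 2) ^ (p + 2) := by
  have hC : 0 ≤ C := by simpa using (abs_nonneg _).trans (hf (1, 0))
  have h := (finTwoArrowEquiv ℤ).symm.summable_iff.2
    (EisensteinSeries.summable_one_div_norm_rpow (k := 2 * p) (by linarith))
  refine (h.mul_left C).of_norm_bounded fun x => ?_
  rcases eq_or_ne x 0 with rfl | hx
  · simp [Real.zero_rpow (show p + 2 ≠ 0 by linarith)]
    positivity
  have hv : 0 < ‖(finTwoArrowEquiv ℤ).symm x‖ := by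
    rw [norm_pos_iff]
    contrapose! hx
    have h0 := congrFun hx 0
    have h1 := congrFun hx 1
    exact Prod.ext (by simpa using h0) (by simpa using h1)
  have hle : ‖(finTwoArrowEquiv ℤ).symm x‖ ^ 2 ≤ (x.1 : ℝ) ^ 2 + (x.2 : ℝ) ^ 2 := by
    refine Real.le_sqrt (norm_nonneg _) (by positivity) |>.1 ?_
    refine (pi_norm_le_iff_of_nonneg (Real.sqrt_nonneg _)).2 fun i => ?_
    apply Real.le_sqrt_of_sq_le
    fin_cases i <;> simp [Int.norm_eq_abs, sq_nonneg]
  set N := ‖(finTwoArrowEquiv ℤ).symm x‖ with hN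
  set r := (x.1 : ℝ) ^ 2 + (x.2 : ℝ) ^ 2 with hr
  have hr0 : 0 < r := lt_of_lt_of_le (by positivity) hle
  have hrp := Real.rpow_pos_of_pos hr0 (p + 2)
  rw [norm_div, Real.norm_eq_abs, Real.norm_of_nonneg hrp.le]
  calc |f x| / r ^ (p + 2) ≤ C * r ^ 2 / r ^ (p + 2) := by gcongr; exact hf x
    _ = C * r ^ (-p) := by
        rw [mul_div_assoc, ← Real.rpow_natCast, ← Real.rpow_sub hr0]
        congr 2
        push_cast
        ring
    _ ≤ C * (N ^ 2) ^ (-p) := by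
        gcongr C * ?_
        exact Real.rpow_le_rpow_of_nonpos (by positivity) hle (by linarith)
    _ = C * N ^ (-(2 * p)) := by
        rw [← Real.rpow_natCast, ← Real.rpow_mul hv.le]
        congr 2
        push_cast
        ring

theorem hasSum_thetaMoment_mul (j k : ℕ) {t : ℝ} (ht : 0 < t) :
    HasSum (fun x : ℤ × ℤ => ((x.1 : ℝ) ^ 2) ^ j * ((x.2 : ℝ) ^ 2) ^ k *
      Real.exp (-Real.pi * ((x.1 : ℝ) ^ 2 + (x.2 : ℝ) ^ 2) * t))
      (thetaMoment j t * thetaMoment k t) := by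
  have hj := summable_thetaMoment j ht
  have hk := summable_thetaMoment k ht
  convert! hj.hasSum.mul hk.hasSum
    (hj.mul_of_nonneg hk (fun n => by positivity) (fun n => by positivity)) using 2 with x
  rw [mul_mul_mul_comm, ← Real.exp_add]
  ring_nf

/-- For every `p > 1`, the sum defining `S₁(p)` converges absolutely and
`S₁(p) > 0`. -/
theorem S1_summable_pos (p : ℝ) (hp : 1 < p) :
    Summable (fun x : {x : ℤ × ℤ // x ≠ 0} =>
      ((p + 1) * ((x.1.2 : ℝ) ^ 2 - (x.1.1 : ℝ) ^ 2) ^ 2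
          - 2 * (x.1.1 : ℝ) ^ 4 - 2 * (x.1.1 : ℝ) ^ 2 * (x.1.2 : ℝ) ^ 2)
        / ((x.1.1 : ℝ) ^ 2 + (x.1.2 : ℝ) ^ 2) ^ (p + 2)) ∧
    0 < S1 p := by
  have hS : Summable fun x : ℤ × ℤ =>
      ((p + 1) * ((x.2 : ℝ) ^ 2 - (x.1 : ℝ) ^ 2) ^ 2
          - 2 * (x.1 : ℝ) ^ 4 - 2 * (x.1 : ℝ) ^ 2 * (x.2 : ℝ) ^ 2)
        / ((x.1 : ℝ) ^ 2 + (x.2 : ℝ) ^ 2) ^ (p + 2) := by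
    refine summable_div_lattice_rpow (C := p + 3) hp fun x => abs_le.2 ⟨?_, ?_⟩
    · nlinarith [sq_nonneg ((x.1 : ℝ) * x.2), pow_nonneg (sq_nonneg (x.1 : ℝ)) 2,
        pow_nonneg (sq_nonneg (x.2 : ℝ)) 2,
        mul_nonneg (by linarith : 0 ≤ p - 1) (sq_nonneg ((x.2 : ℝ) ^ 2 - (x.1 : ℝ) ^ 2)),
        mul_nonneg (by linarith : 0 ≤ p - 1) (sq_nonneg ((x.2 : ℝ) ^ 2 + (x.1 : ℝ) ^ 2))]
    · nlinarith [sq_nonneg ((x.1 : ℝ) * x.2), pow_nonneg (sq_nonneg (x.1 : ℝ)) 2,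
        pow_nonneg (sq_nonneg (x.2 : ℝ)) 2,
        mul_nonneg (by linarith : 0 ≤ p - 1) (sq_nonneg ((x.1 : ℝ) * x.2))]
  refine ⟨hS.subtype {x | x ≠ 0}, mul_pos (by linarith) ?_⟩
  have hB : Summable fun x : ℤ × ℤ => 4 * (p - 1) * (x.1 : ℝ) ^ 2 * (x.2 : ℝ) ^ 2
      / ((x.1 : ℝ) ^ 2 + (x.2 : ℝ) ^ 2) ^ (p + 2) := by
    refine summable_div_lattice_rpow (C := 4 * (p - 1)) hp fun x => ?_
    have h1 : 0 ≤ 4 * (p - 1) := by linarith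
    rw [abs_of_nonneg (by positivity), mul_assoc]
    gcongr
    nlinarith [sq_nonneg ((x.1 : ℝ) * x.2), pow_nonneg (sq_nonneg (x.1 : ℝ)) 2,
      pow_nonneg (sq_nonneg (x.2 : ℝ)) 2]
  have hBpos := hB.tsum_pos (fun x => by
    have h1 : 0 ≤ 4 * (p - 1) := by linarith
    positivity) (1, 1) (by
    have h1 : 0 < 4 * (p - 1) := by linarith
    simp only [Int.cast_one]
    positivity)
  have hA := tsum_div_rpow_nonneg
    (a := fun x : ℤ × ℤ => (p - 1) * (x.1 : ℝ) ^ 4 + (p + 1) * (x.2 : ℝ) ^ 4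
      - 6 * p * ((x.1 : ℝ) ^ 2 * (x.2 : ℝ) ^ 2))
    (q := fun x : ℤ × ℤ => (x.1 : ℝ) ^ 2 + (x.2 : ℝ) ^ 2) (s := p + 2)
    (F := fun t => 2 * p * (thetaMoment 2 t * thetaMoment 0 t - 3 * thetaMoment 1 t ^ 2))
    (fun x => ?_) (by linarith) (fun t ht => ?_)
    (fun t ht => mul_nonneg (by linarith) (thetaMoment_discr_nonneg ht))
    ((hS.sub hB).congr fun x => by ring)
  · have hsub := tsum_subtype_eq_of_support_subset (s := {x : ℤ × ℤ | x ≠ 0})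
      (f := fun x : ℤ × ℤ => ((p + 1) * ((x.2 : ℝ) ^ 2 - (x.1 : ℝ) ^ 2) ^ 2
          - 2 * (x.1 : ℝ) ^ 4 - 2 * (x.1 : ℝ) ^ 2 * (x.2 : ℝ) ^ 2)
        / ((x.1 : ℝ) ^ 2 + (x.2 : ℝ) ^ 2) ^ (p + 2)) (by
        rintro x hx rfl
        simp at hx)
    refine lt_of_lt_of_eq ?_ hsub.symm
    have hd := hS.tsum_sub hB
    have he : ∀ x : ℤ × ℤ, ((p - 1) * (x.1 : ℝ) ^ 4 + (p + 1) * (x.2 : ℝ) ^ 4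
        - 6 * p * ((x.1 : ℝ) ^ 2 * (x.2 : ℝ) ^ 2)) / ((x.1 : ℝ) ^ 2 + (x.2 : ℝ) ^ 2) ^ (p + 2) =
        ((p + 1) * ((x.2 : ℝ) ^ 2 - (x.1 : ℝ) ^ 2) ^ 2
          - 2 * (x.1 : ℝ) ^ 4 - 2 * (x.1 : ℝ) ^ 2 * (x.2 : ℝ) ^ 2)
        / ((x.1 : ℝ) ^ 2 + (x.2 : ℝ) ^ 2) ^ (p + 2) -
        4 * (p - 1) * (x.1 : ℝ) ^ 2 * (x.2 : ℝ) ^ 2 / ((x.1 : ℝ) ^ 2 + (x.2 : ℝ) ^ 2) ^ (p + 2) := fun x => by ring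
    rw [tsum_congr he, hd] at hA
    linarith
  · rcases eq_or_ne x 0 with rfl | hx
    · simp
    · right
      by_contra! h
      have h1 : (x.1 : ℝ) = 0 := by nlinarith [sq_nonneg (x.1 : ℝ), sq_nonneg (x.2 : ℝ)]
      have h2 : (x.2 : ℝ) = 0 := by nlinarith [sq_nonneg (x.1 : ℝ), sq_nonneg (x.2 : ℝ)]
      exact hx (Prod.ext (by exact_mod_cast h1) (by exact_mod_cast h2))
  · have h := (((hasSum_thetaMoment_mul 2 0 ht).mul_left (p - 1)).add
      ((hasSum_thetaMoment_mul 0 2 ht).mul_left (p + 1))).sub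
      ((hasSum_thetaMoment_mul 1 1 ht).mul_left (6 * p))
    convert! h using 1
    · funext x
      ring
    · ring
end
end

section
/- For every real q > 1, the sum S₂(q) := 4q Σ_{(m,n)∈ℤ²∖{0}} (−1)^{m+n}[(q+1)(n²−m²)² − 2m⁴ − 2m²n²]/(m²+n²)^{q+2} converges absolutely and S₂(q) < 0. -/
noncomputable section

open Filter Topology MeasureTheory

/-- The `q`-Pochhammer product `∏_{k=1}^n (1 - Q^k)`. -/
def qPoch (Q : ℝ) (n : ℕ) : ℝ := ∏ k ∈ Finset.range n, (1 - Q ^ (k + 1))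

/-- The reciprocal of `qPoch`, extended by zero to negative integers. -/
def qPochInv (Q : ℝ) (n : ℤ) : ℝ := if 0 ≤ n then (qPoch Q n.toNat)⁻¹ else 0

lemma one_sub_pow_pos {Q : ℝ} (h0 : 0 ≤ Q) (h1 : Q < 1) (k : ℕ) : 0 < 1 - Q ^ (k + 1) :=
  sub_pos.2 (pow_lt_one₀ h0 h1 k.succ_ne_zero)

lemma qPoch_pos {Q : ℝ} (h0 : 0 ≤ Q) (h1 : Q < 1) (n : ℕ) : 0 < qPoch Q n :=
  Finset.prod_pos fun k _ => one_sub_pow_pos h0 h1 k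

lemma qPoch_succ (Q : ℝ) (n : ℕ) : qPoch Q (n + 1) = qPoch Q n * (1 - Q ^ (n + 1)) :=
  Finset.prod_range_succ _ _

lemma qPoch_antitone {Q : ℝ} (h0 : 0 ≤ Q) (h1 : Q < 1) : Antitone (qPoch Q) := by
  refine antitone_nat_of_succ_le fun n => ?_
  rw [qPoch_succ]
  exact mul_le_of_le_one_right (qPoch_pos h0 h1 n).le (by linarith [pow_nonneg h0 (n + 1)])

lemma qPochInv_eq {Q : ℝ} (h0 : 0 < Q) (h1 : Q < 1) (n : ℤ) :
    qPochInv Q n = qPochInv Q (n + 1) * (1 - Q ^ (n + 1)) := by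
  rcases lt_trichotomy n (-1) with h | rfl | h
  · simp [qPochInv, show ¬ 0 ≤ n by omega, show ¬ 0 ≤ n + 1 by omega]
  · simp [qPochInv]
  · lift n to ℕ using by omega
    have hn : (0 : ℤ) ≤ (n : ℤ) + 1 := by omega
    have e : ((n : ℤ) + 1).toNat = n + 1 := by omega
    have := one_sub_pow_pos h0.le h1 n
    simp only [qPochInv, Int.natCast_nonneg, if_true, hn, e, Int.toNat_natCast, qPoch_succ]
    have h2 : Q ^ ((n : ℤ) + 1) = Q ^ (n + 1) := by exact_mod_cast zpow_natCast Q (n + 1)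
    have := qPoch_pos h0.le h1 n
    rw [h2]
    field_simp

/-- The summand of the finite form of Gauss' identity. -/
def gaussTerm (x : ℝ) (N : ℕ) (j : ℤ) : ℝ :=
  qPoch (x ^ 2) (2 * N) * (x ^ (j ^ 2) * qPochInv (x ^ 2) (N + j) * qPochInv (x ^ 2) (N - j))

lemma gaussTerm_succ {x : ℝ} (h0 : 0 < x) (h1 : x < 1) (N : ℕ) (j : ℤ) :
    gaussTerm x (N + 1) j = (1 + x ^ (4 * N + 2)) * gaussTerm x N j
      + x ^ (2 * N + 1) * (gaussTerm x N (j - 1) + gaussTerm x N (j + 1)) := by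
  have hQ0 : 0 < x ^ 2 := by positivity
  have hQ1 : x ^ 2 < 1 := pow_lt_one₀ h0.le h1 two_ne_zero
  have hx : x ≠ 0 := h0.ne'
  have A1 := qPochInv_eq hQ0 hQ1 (N + j)
  have A2 := qPochInv_eq hQ0 hQ1 (N + j - 1)
  have B1 := qPochInv_eq hQ0 hQ1 (N - j)
  have B2 := qPochInv_eq hQ0 hQ1 (N - j - 1)
  rw [show (N : ℤ) + j - 1 + 1 = N + j by ring] at A2
  rw [show (N : ℤ) - j - 1 + 1 = N - j by ring] at B2
  rw [A1] at A2
  rw [B1] at B2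
  unfold gaussTerm
  rw [show 2 * (N + 1) = 2 * N + 1 + 1 by ring, qPoch_succ, qPoch_succ]
  push_cast
  rw [show (N : ℤ) + 1 + j = N + j + 1 by ring, show (N : ℤ) + 1 - j = N - j + 1 by ring,
    show (N : ℤ) + (j - 1) = N + j - 1 by ring, show (N : ℤ) - (j - 1) = N - j + 1 by ring,
    show (N : ℤ) + (j + 1) = N + j + 1 by ring, show (N : ℤ) - (j + 1) = N - j - 1 by ring,
    A2, B2, A1, B1]
  generalize qPochInv (x ^ 2) (N + j + 1) = A
  generalize qPochInv (x ^ 2) (N - j + 1) = B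
  generalize qPoch (x ^ 2) (2 * N) = C
  have e1 : (x ^ 2) ^ ((N : ℤ) + j + 1) = x ^ (2 * N + 2) * (x ^ j) ^ 2 := by
    rw [← zpow_natCast, ← zpow_natCast, ← zpow_natCast, ← zpow_mul, ← zpow_mul, ← zpow_add₀ hx]
    congr 1; push_cast; ring
  have e2 : (x ^ 2) ^ ((N : ℤ) - j + 1) = x ^ (2 * N + 2) * ((x ^ j)⁻¹) ^ 2 := by
    rw [← zpow_neg, ← zpow_natCast, ← zpow_natCast, ← zpow_natCast, ← zpow_mul, ← zpow_mul,
      ← zpow_add₀ hx]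
    congr 1; push_cast; ring
  have e3 : (x ^ 2) ^ ((N : ℤ) + j) = x ^ (2 * N) * (x ^ j) ^ 2 := by
    rw [← zpow_natCast, ← zpow_natCast, ← zpow_natCast, ← zpow_mul, ← zpow_mul, ← zpow_add₀ hx]
    congr 1; push_cast; ring
  have e4 : (x ^ 2) ^ ((N : ℤ) - j) = x ^ (2 * N) * ((x ^ j)⁻¹) ^ 2 := by
    rw [← zpow_neg, ← zpow_natCast, ← zpow_natCast, ← zpow_natCast, ← zpow_mul, ← zpow_mul,
      ← zpow_add₀ hx]
    congr 1; push_cast; ring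
  have e5 : x ^ ((j - 1) ^ 2) = x ^ (j ^ 2) * ((x ^ j)⁻¹) ^ 2 * x := by
    rw [← zpow_neg, ← zpow_natCast, ← zpow_mul, ← zpow_add₀ hx, ← zpow_add_one₀ hx]
    congr 1; push_cast; ring
  have e6 : x ^ ((j + 1) ^ 2) = x ^ (j ^ 2) * (x ^ j) ^ 2 * x := by
    rw [← zpow_natCast, ← zpow_mul, ← zpow_add₀ hx, ← zpow_add_one₀ hx]
    congr 1; push_cast; ring
  rw [e1, e2, e3, e4, e5, e6]
  have hy : x ^ j ≠ 0 := zpow_ne_zero _ hx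
  generalize x ^ (j ^ 2) = E
  generalize x ^ j = y at hy ⊢
  field_simp
  ring

lemma hasSum_gaussTerm {x : ℝ} (h0 : 0 < x) (h1 : x < 1) (N : ℕ) :
    HasSum (fun j : ℤ => (-1 : ℝ) ^ j * gaussTerm x N j)
      (∏ k ∈ Finset.range N, (1 - x ^ (2 * k + 1)) ^ 2) := by
  induction N with
  | zero =>
    have := hasSum_single (f := fun j : ℤ => (-1 : ℝ) ^ j * gaussTerm x 0 j) 0 (fun j hj => by
      rcases lt_or_gt_of_ne hj with h | h
      · simp [gaussTerm, qPochInv, show ¬ 0 ≤ j by omega]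
      · simp [gaussTerm, qPochInv, show ¬ j ≤ 0 by omega])
    simpa [gaussTerm, qPochInv, qPoch] using this
  | succ N ih =>
    have hm := (Equiv.subRight (1 : ℤ)).hasSum_iff.2 ih
    have hp := (Equiv.addRight (1 : ℤ)).hasSum_iff.2 ih
    have := (ih.mul_left (1 + x ^ (4 * N + 2))).sub ((hm.add hp).mul_left (x ^ (2 * N + 1)))
    rw [Finset.prod_range_succ]
    convert! this using 1
    · funext j
      have h1' : (-1 : ℝ) ≠ 0 := by norm_num
      simp only [gaussTerm_succ h0 h1, Function.comp, Equiv.subRight_apply, Equiv.coe_addRight,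
        zpow_sub_one₀ h1', zpow_add_one₀ h1']
      ring
    · ring

lemma exists_tendsto_qPoch {Q : ℝ} (h0 : 0 ≤ Q) (h1 : Q < 1) :
    ∃ L, 0 < L ∧ Tendsto (qPoch Q) atTop (𝓝 L) ∧ ∀ n, L ≤ qPoch Q n := by
  have hs : Summable fun k : ℕ => ‖-Q ^ (k + 1)‖ := by
    simp only [norm_neg, norm_pow, Real.norm_of_nonneg h0]
    exact (summable_nat_add_iff 1).2 (summable_geometric_of_lt_one h0 h1)
  have ht : Tendsto (qPoch Q) atTop (𝓝 (∏' k : ℕ, (1 + -Q ^ (k + 1)))) := by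
    have := (multipliable_one_add_of_summable hs).hasProd.tendsto_prod_nat
    simp only [← sub_eq_add_neg] at this ⊢
    exact this
  have hne := tprod_one_add_ne_zero_of_summable
    (fun k => by simpa only [← sub_eq_add_neg] using (one_sub_pow_pos h0 h1 k).ne') hs
  exact ⟨_, (ge_of_tendsto' ht fun n => (qPoch_pos h0 h1 n).le).lt_of_ne' hne, ht,
    (qPoch_antitone h0 h1).le_of_tendsto ht⟩

lemma qPoch_two_mul (x : ℝ) (N : ℕ) :
    qPoch x (2 * N) = qPoch (x ^ 2) N * ∏ k ∈ Finset.range N, (1 - x ^ (2 * k + 1)) := by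
  induction N with
  | zero => simp [qPoch]
  | succ N ih =>
    rw [show 2 * (N + 1) = 2 * N + 1 + 1 by ring, qPoch_succ, qPoch_succ, ih, qPoch_succ,
      Finset.prod_range_succ]
    ring

/-- The partial products of Gauss' product for the alternating theta function. -/
def gaussProd (x : ℝ) (N : ℕ) : ℝ :=
  qPoch (x ^ 2) N * ∏ k ∈ Finset.range N, (1 - x ^ (2 * k + 1)) ^ 2

lemma exists_le_gaussProd {x : ℝ} (h0 : 0 < x) (h1 : x < 1) :
    ∃ c, 0 < c ∧ ∀ N, c ≤ gaussProd x N := by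
  obtain ⟨L, hL, -, hLb⟩ := exists_tendsto_qPoch h0.le h1
  have hQ1 : x ^ 2 < 1 := pow_lt_one₀ h0.le h1 two_ne_zero
  refine ⟨L ^ 2, by positivity, fun N => ?_⟩
  have hb := qPoch_pos (sq_nonneg x) hQ1 N
  have hb1 : qPoch (x ^ 2) N ≤ 1 := by
    simpa [qPoch] using qPoch_antitone (sq_nonneg x) hQ1 (Nat.zero_le N)
  calc L ^ 2 ≤ qPoch x (2 * N) ^ 2 := by gcongr; exact hLb _
    _ = qPoch (x ^ 2) N * gaussProd x N := by
      rw [qPoch_two_mul, gaussProd, Finset.prod_pow]; ring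
    _ ≤ gaussProd x N := mul_le_of_le_one_left
      (mul_nonneg hb.le (Finset.prod_nonneg fun _ _ => sq_nonneg _)) hb1

lemma tendsto_qPochInv {Q L : ℝ} (hL : 0 < L) (h : Tendsto (qPoch Q) atTop (𝓝 L)) :
    Tendsto (qPochInv Q) atTop (𝓝 L⁻¹) := by
  have : Tendsto Int.toNat atTop atTop :=
    tendsto_atTop.2 fun n => (eventually_ge_atTop (n : ℤ)).mono fun j hj => by omega
  refine ((h.comp this).inv₀ hL.ne').congr' ?_
  filter_upwards [eventually_ge_atTop 0] with n hn
  simp [qPochInv, hn]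

lemma norm_qPochInv_le {Q L : ℝ} (hL : 0 < L) (h : ∀ n, L ≤ qPoch Q n) (n : ℤ) :
    ‖qPochInv Q n‖ ≤ L⁻¹ := by
  unfold qPochInv
  split_ifs
  · rw [norm_inv, Real.norm_of_nonneg (hL.le.trans (h _))]
    exact inv_anti₀ hL (h _)
  · simpa using hL.le

/-- Gauss' product formula for the alternating theta series. -/
lemma tendsto_gaussProd {x : ℝ} (h0 : 0 < x) (h1 : x < 1)
    (hs : Summable fun j : ℤ => x ^ (j ^ 2)) :
    Tendsto (gaussProd x) atTop (𝓝 (∑' j : ℤ, (-1 : ℝ) ^ j * x ^ (j ^ 2))) := by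
  have hQ1 : x ^ 2 < 1 := pow_lt_one₀ h0.le h1 two_ne_zero
  obtain ⟨L, hL, hLt, hLb⟩ := exists_tendsto_qPoch (sq_nonneg x) hQ1
  have hinv := tendsto_qPochInv hL hLt
  have hcast : Tendsto (fun N : ℕ => (N : ℤ)) atTop atTop := tendsto_natCast_atTop_atTop
  have key := tendsto_tsum_of_dominated_convergence (𝓕 := atTop)
    (f := fun (N : ℕ) (j : ℤ) => (-1 : ℝ) ^ j *
      (x ^ (j ^ 2) * qPochInv (x ^ 2) (N + j) * qPochInv (x ^ 2) (N - j)))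
    (g := fun j : ℤ => (-1 : ℝ) ^ j * (x ^ (j ^ 2) * L⁻¹ * L⁻¹))
    (bound := fun j : ℤ => x ^ (j ^ 2) * L⁻¹ * L⁻¹)
    ((hs.mul_right _).mul_right _)
    (fun j => (((hinv.comp (tendsto_atTop_add_const_right _ j hcast)).const_mul _).mul
      (hinv.comp (tendsto_atTop_add_const_right _ (-j) hcast))).const_mul _)
    (Eventually.of_forall fun N j => by
      rw [norm_mul, norm_mul, norm_mul, norm_zpow, norm_neg, norm_one, one_zpow, one_mul,
        Real.norm_of_nonneg (zpow_nonneg h0.le _)]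
      gcongr
      · exact norm_qPochInv_le hL hLb _
      · exact norm_qPochInv_le hL hLb _)
  have h2 : Tendsto (fun N : ℕ => qPoch (x ^ 2) (2 * N)) atTop (𝓝 L) :=
    hLt.comp (tendsto_id.const_mul_atTop' two_pos)
  convert! (hLt.mul h2).mul key using 1
  · funext N
    have hb := qPoch_pos (sq_nonneg x) hQ1 (2 * N)
    rw [gaussProd, ← (hasSum_gaussTerm h0 h1 N).tsum_eq, mul_assoc,
      ← tsum_mul_left (a := qPoch _ (2 * N))]
    congr 1
    refine tsum_congr fun j => ?_
    rw [gaussTerm]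
    ring
  · congr 1
    rw [← tsum_mul_left]
    refine tsum_congr fun j => ?_
    field_simp

/-- The function `s ↦ log (1 - e^{-e^s})`, whose translates make up the logarithm of the Gauss
product. -/
def logFactor (s : ℝ) : ℝ := Real.log (1 - Real.exp (-Real.exp s))

/-- The derivative of `logFactor`. -/
def logFactorDeriv (s : ℝ) : ℝ := Real.exp s / (Real.exp (Real.exp s) - 1)

lemma hasDerivAt_logFactor (s : ℝ) : HasDerivAt logFactor (logFactorDeriv s) s := by
  have h : 0 < 1 - Real.exp (-Real.exp s) :=
    sub_pos.2 (Real.exp_lt_one_iff.2 (neg_lt_zero.2 (Real.exp_pos s)))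
  have h' : 0 < Real.exp (Real.exp s) - 1 := sub_pos.2 (Real.one_lt_exp_iff.2 (Real.exp_pos s))
  convert! (((Real.hasDerivAt_exp s).neg.exp).const_sub 1).log h.ne' using 1
  rw [Pi.neg_apply, Real.exp_neg] at *
  rw [logFactorDeriv]
  have := Real.exp_pos (Real.exp s)
  field_simp

lemma exists_hasDerivAt_logFactorDeriv (s : ℝ) :
    ∃ d < 0, HasDerivAt logFactorDeriv d s := by
  have h' : 0 < Real.exp (Real.exp s) - 1 := sub_pos.2 (Real.one_lt_exp_iff.2 (Real.exp_pos s))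
  refine ⟨_, ?_, (Real.hasDerivAt_exp s).div ((Real.hasDerivAt_exp s).exp.sub_const 1) h'.ne'⟩
  refine div_neg_of_neg_of_pos ?_ (by positivity)
  have h1 : -Real.exp s + 1 < Real.exp (-Real.exp s) :=
    Real.add_one_lt_exp (neg_ne_zero.2 (Real.exp_ne_zero s))
  have h2 := mul_lt_mul_of_pos_right h1 (Real.exp_pos (Real.exp s))
  rw [← Real.exp_add, neg_add_cancel, Real.exp_zero] at h2
  nlinarith [Real.exp_pos s]

lemma concaveOn_logFactor : ConcaveOn ℝ Set.univ logFactor := by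
  have hd : deriv logFactor = logFactorDeriv := funext fun s => (hasDerivAt_logFactor s).deriv
  refine Antitone.concaveOn_univ_of_deriv
    (fun s => (hasDerivAt_logFactor s).differentiableAt) ?_
  rw [hd]
  refine antitone_of_deriv_nonpos
    (fun s => let ⟨_, _, h⟩ := exists_hasDerivAt_logFactorDeriv s; h.differentiableAt) fun s => ?_
  obtain ⟨d, hd, h⟩ := exists_hasDerivAt_logFactorDeriv s
  exact h.deriv ▸ hd.le

lemma concaveOn_logFactor_add (c : ℝ) : ConcaveOn ℝ Set.univ fun s => logFactor (s + c) := by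
  have h := concaveOn_logFactor.translate_left c
  rw [Set.preimage_univ] at h
  exact h

lemma one_sub_exp_pow_eq (s : ℝ) (n : ℕ) :
    Real.log (1 - Real.exp (-Real.exp s) ^ (n + 1)) = logFactor (s + Real.log (n + 1)) := by
  rw [logFactor, Real.exp_add, Real.exp_log (by positivity), ← Real.exp_nat_mul]
  congr 3
  push_cast
  ring_nf

lemma log_gaussProd (s : ℝ) (N : ℕ) :
    Real.log (gaussProd (Real.exp (-Real.exp s)) (N + 1)) - 2 * logFactor s =
      ∑ k ∈ Finset.range (N + 1), logFactor (s + Real.log ((2 * k + 1 : ℕ) + 1))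
        + 2 * ∑ k ∈ Finset.range N, logFactor (s + Real.log ((2 * k + 2 : ℕ) + 1)) := by
  set x := Real.exp (-Real.exp s) with hx
  have h0 : 0 < x := Real.exp_pos _
  have h1 : x < 1 := Real.exp_lt_one_iff.2 (neg_lt_zero.2 (Real.exp_pos s))
  have hp (n : ℕ) : 1 - x ^ (n + 1) ≠ 0 := (one_sub_pow_pos h0.le h1 n).ne'
  have hp2 (n : ℕ) : 1 - (x ^ 2) ^ (n + 1) ≠ 0 := by
    rw [← pow_mul]; exact hp (2 * n + 1)
  rw [gaussProd, qPoch, Real.log_mul (Finset.prod_ne_zero_iff.2 fun k _ => hp2 k)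
    (Finset.prod_ne_zero_iff.2 fun k _ => pow_ne_zero 2 (hp _)),
    Real.log_prod fun k _ => hp2 k, Real.log_prod fun k _ => pow_ne_zero 2 (hp _)]
  simp only [← pow_mul, Real.log_pow, ← Finset.mul_sum]
  rw [Finset.sum_range_succ' (fun k => Real.log (1 - x ^ (2 * k + 1)))]
  simp only [show ∀ k, 2 * (k + 1) = (2 * k + 1) + 1 by intro; ring, one_sub_exp_pow_eq, hx]
  simp [logFactor]
  ring

lemma concaveOn_log_gaussProd (N : ℕ) : ConcaveOn ℝ Set.univ fun s =>
    Real.log (gaussProd (Real.exp (-Real.exp s)) (N + 1)) - 2 * logFactor s := by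
  simp only [log_gaussProd]
  have hsum (f : ℕ → ℝ) (n : ℕ) :
      ConcaveOn ℝ Set.univ fun s => ∑ k ∈ Finset.range n, logFactor (s + f k) := by
    induction n with
    | zero => simpa using concaveOn_const (0 : ℝ) convex_univ
    | succ n ih =>
      simp only [Finset.sum_range_succ]
      exact ih.add (concaveOn_logFactor_add _)
  exact (hsum _ _).add ((hsum _ _).smul zero_le_two)

/-- The series `∑ (-1)^m m^{2k} e^{-tm²}`, that is, up to sign, the `k`-th derivative of the
alternating theta series. -/
def altTheta (k : ℕ) (t : ℝ) : ℝ :=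
  ∑' m : ℤ, (-1 : ℝ) ^ m * (((m : ℝ) ^ 2) ^ k * Real.exp (-(t * (m : ℝ) ^ 2)))

lemma summable_sq_pow_mul_exp (k : ℕ) {t : ℝ} (ht : 0 < t) :
    Summable fun m : ℤ => ((m : ℝ) ^ 2) ^ k * Real.exp (-(t * (m : ℝ) ^ 2)) := by
  refine (summable_pow_mul_jacobiTheta₂_term_bound 0 (div_pos ht Real.pi_pos) (2 * k)).congr
    fun m => ?_
  rw [pow_mul, Int.cast_abs, sq_abs]
  congr 2
  have := Real.pi_pos
  field_simp
  ring

lemma norm_altTheta_term (k : ℕ) (t : ℝ) (m : ℤ) :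
    ‖(-1 : ℝ) ^ m * (((m : ℝ) ^ 2) ^ k * Real.exp (-(t * (m : ℝ) ^ 2)))‖ =
      ((m : ℝ) ^ 2) ^ k * Real.exp (-(t * (m : ℝ) ^ 2)) := by
  rw [norm_mul, norm_zpow, norm_neg, norm_one, one_zpow, one_mul,
    Real.norm_of_nonneg (by positivity)]

lemma summable_altTheta (k : ℕ) {t : ℝ} (ht : 0 < t) : Summable fun m : ℤ =>
    (-1 : ℝ) ^ m * (((m : ℝ) ^ 2) ^ k * Real.exp (-(t * (m : ℝ) ^ 2))) :=
  .of_norm_bounded (summable_sq_pow_mul_exp k ht) fun m => (norm_altTheta_term k t m).le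

lemma hasDerivAt_altTheta (k : ℕ) {t : ℝ} (ht : 0 < t) :
    HasDerivAt (altTheta k) (-altTheta (k + 1) t) t := by
  have hmem : t ∈ Set.Ioi (t / 2) := half_lt_self ht
  have := hasDerivAt_tsum_of_isPreconnected
    (g := fun (m : ℤ) t => (-1 : ℝ) ^ m * (((m : ℝ) ^ 2) ^ k * Real.exp (-(t * (m : ℝ) ^ 2))))
    (g' := fun (m : ℤ) t =>
      -((-1 : ℝ) ^ m * (((m : ℝ) ^ 2) ^ (k + 1) * Real.exp (-(t * (m : ℝ) ^ 2)))))
    (summable_sq_pow_mul_exp (k + 1) (half_pos ht)) isOpen_Ioi isPreconnected_Ioi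
    (fun m y _ => by
      convert! ((((hasDerivAt_id y).mul_const ((m : ℝ) ^ 2)).neg.exp).const_mul
        (((m : ℝ) ^ 2) ^ k)).const_mul ((-1 : ℝ) ^ m) using 1
      simp only [Pi.neg_apply, id]
      ring)
    (fun m y hy => by
      rw [norm_neg, norm_altTheta_term]
      have : t / 2 ≤ y := le_of_lt hy
      gcongr)
    hmem (summable_altTheta k ht) hmem
  rwa [tsum_neg] at this

lemma tendsto_gaussProd_altTheta {t : ℝ} (ht : 0 < t) :
    Tendsto (gaussProd (Real.exp (-t))) atTop (𝓝 (altTheta 0 t)) := by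
  have e (j : ℤ) : Real.exp (-t) ^ (j ^ 2) = ((j : ℝ) ^ 2) ^ 0 * Real.exp (-(t * (j : ℝ) ^ 2)) := by
    rw [← Real.rpow_intCast, ← Real.exp_mul, pow_zero, one_mul]
    congr 1
    push_cast
    ring
  have h := tendsto_gaussProd (Real.exp_pos (-t)) (by simpa using ht)
    ((summable_sq_pow_mul_exp 0 ht).congr fun j => (e j).symm)
  simp only [e] at h
  exact h

lemma altTheta_zero_pos {t : ℝ} (ht : 0 < t) : 0 < altTheta 0 t :=
  let ⟨_, hc, h⟩ := exists_le_gaussProd (Real.exp_pos (-t)) (by simpa using ht)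
  hc.trans_le (ge_of_tendsto' (tendsto_gaussProd_altTheta ht) h)

lemma concaveOn_log_altTheta : ConcaveOn ℝ Set.univ fun s =>
    Real.log (altTheta 0 (Real.exp s)) - 2 * logFactor s := by
  have ht (s : ℝ) : Tendsto (fun N : ℕ =>
      Real.log (gaussProd (Real.exp (-Real.exp s)) (N + 1)) - 2 * logFactor s) atTop
      (𝓝 (Real.log (altTheta 0 (Real.exp s)) - 2 * logFactor s)) :=
    (((tendsto_gaussProd_altTheta (Real.exp_pos s)).comp (tendsto_add_atTop_nat 1)).log
      (altTheta_zero_pos (Real.exp_pos s)).ne').sub_const _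
  refine ⟨convex_univ, fun x hx y hy a b ha hb hab => ?_⟩
  exact le_of_tendsto_of_tendsto' (((ht x).const_smul a).add ((ht y).const_smul b)) (ht _)
    fun N => (concaveOn_log_gaussProd N).2 hx hy ha hb hab

/-- Strict logarithmic concavity of `s ↦ ϑ(e^s)` for the alternating theta series `ϑ`. -/
lemma altTheta_mul_lt {t : ℝ} (ht : 0 < t) :
    t ^ 2 * (altTheta 2 t * altTheta 0 t - altTheta 1 t ^ 2) - t * (altTheta 1 t * altTheta 0 t)
      < 0 := by
  have hd (k : ℕ) (s : ℝ) : HasDerivAt (fun s => altTheta k (Real.exp s))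
      (-altTheta (k + 1) (Real.exp s) * Real.exp s) s :=
    (hasDerivAt_altTheta k (Real.exp_pos s)).comp s (Real.hasDerivAt_exp s)
  have hpos (s : ℝ) := altTheta_zero_pos (Real.exp_pos s)
  have h1 (s : ℝ) : HasDerivAt (fun s => Real.log (altTheta 0 (Real.exp s)) - 2 * logFactor s)
      (-altTheta 1 (Real.exp s) * Real.exp s / altTheta 0 (Real.exp s) - 2 * logFactorDeriv s) s :=
    ((hd 0 s).log (hpos s).ne').sub ((hasDerivAt_logFactor s).const_mul 2)
  have hanti := concaveOn_log_altTheta.antitoneOn_deriv fun s _ => (h1 s).differentiableAt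
  rw [antitoneOn_univ, funext fun s => (h1 s).deriv] at hanti
  set s := Real.log t with hs
  have hts : Real.exp s = t := Real.exp_log ht
  obtain ⟨d, hd0, hds⟩ := exists_hasDerivAt_logFactorDeriv s
  have h2 : HasDerivAt (fun s =>
      -altTheta 1 (Real.exp s) * Real.exp s / altTheta 0 (Real.exp s) - 2 * logFactorDeriv s) _ s :=
    (((hd 1 s).neg.mul (Real.hasDerivAt_exp s)).div (hd 0 s) (hpos s).ne').sub
    (hds.const_mul 2)
  have h3 := hanti.deriv_nonpos (x := s)
  rw [h2.deriv] at h3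
  have h4 := hpos s
  simp only [Pi.mul_apply, Pi.neg_apply, hts, zero_add, Nat.reduceAdd] at h3 h4
  have h5 := (sub_nonpos.1 h3).trans_lt (by linarith : 2 * d < 0)
  rw [div_lt_iff₀ (by positivity), zero_mul] at h5
  linarith

lemma integrable_tsum_of_summable_integral_norm {α ι : Type*} [MeasurableSpace α] [Countable ι]
    {μ : Measure α} {F : ι → α → ℝ} (hF : ∀ i, Integrable (F i) μ)
    (hs : Summable fun i => ∫ a, ‖F i a‖ ∂μ)
    (hm : AEStronglyMeasurable (fun a => ∑' i, F i a) μ) :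
    Integrable (fun a => ∑' i, F i a) μ := by
  refine ⟨hm, ?_⟩
  calc ∫⁻ a, ‖∑' i, F i a‖ₑ ∂μ ≤ ∫⁻ a, ∑' i, ‖F i a‖ₑ ∂μ :=
        lintegral_mono fun a => enorm_tsum_le_tsum_enorm
    _ = ∑' i, ∫⁻ a, ‖F i a‖ₑ ∂μ := lintegral_tsum fun i => (hF i).1.enorm
    _ = ∑' i, ENNReal.ofReal (∫ a, ‖F i a‖ ∂μ) :=
      tsum_congr fun i => (ofReal_integral_norm_eq_lintegral_enorm (hF i)).symm
    _ < ⊤ := hs.tsum_ofReal_lt_top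

lemma integrableOn_rpow_mul_exp_neg_mul {a r : ℝ} (ha : 0 < a) (hr : 0 < r) :
    IntegrableOn (fun t : ℝ => t ^ (a - 1) * Real.exp (-(r * t))) (Set.Ioi 0) := by
  simpa using integrableOn_rpow_mul_exp_neg_mul_rpow (by linarith : -1 < a - 1) one_pos hr

lemma summable_sq_add_sq_rpow {q : ℝ} (hq : 1 < q) :
    Summable fun x : ℤ × ℤ => ((x.1 : ℝ) ^ 2 + (x.2 : ℝ) ^ 2) ^ (-q) := by
  have h := (finTwoArrowEquiv ℤ).symm.summable_iff.2
    (EisensteinSeries.summable_one_div_norm_rpow (k := 2 * q) (by linarith))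
  refine .of_nonneg_of_le (fun x => by positivity) (fun x => ?_) h
  rcases eq_or_ne x 0 with rfl | hx
  · simp [Real.zero_rpow (by linarith : -q ≠ 0), Real.rpow_nonneg]
  have hn : ‖(finTwoArrowEquiv ℤ).symm x‖ ^ 2 ≤ (x.1 : ℝ) ^ 2 + (x.2 : ℝ) ^ 2 := by
    have h2 : ‖(finTwoArrowEquiv ℤ).symm x‖ ≤ √((x.1 : ℝ) ^ 2 + (x.2 : ℝ) ^ 2) := by
      refine (pi_norm_le_iff_of_nonneg (Real.sqrt_nonneg _)).2 fun i => ?_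
      fin_cases i
      · exact (Int.norm_eq_abs _).trans_le (Real.abs_le_sqrt (by simp [sq_nonneg]))
      · exact (Int.norm_eq_abs _).trans_le (Real.abs_le_sqrt (by simp [sq_nonneg]))
    calc _ ≤ √((x.1 : ℝ) ^ 2 + (x.2 : ℝ) ^ 2) ^ 2 := by gcongr
      _ = _ := Real.sq_sqrt (by positivity)
  have hpos : 0 < ‖(finTwoArrowEquiv ℤ).symm x‖ := by
    refine norm_pos_iff.2 fun h0 => hx ?_
    have := congrArg (finTwoArrowEquiv ℤ) h0
    exact (by simpa using this : x = (0, 0))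
  calc ((x.1 : ℝ) ^ 2 + (x.2 : ℝ) ^ 2) ^ (-q)
      ≤ (‖(finTwoArrowEquiv ℤ).symm x‖ ^ 2) ^ (-q) :=
        Real.rpow_le_rpow_of_nonpos (by positivity) hn (by linarith)
    _ = _ := by
      rw [← Real.rpow_natCast, ← Real.rpow_mul hpos.le, Function.comp]
      congr 1
      push_cast
      ring

/-- The integrand representing, up to the factor `Γ(q + 1)`, the summand of `S2 q`. -/
def S2Integrand (q : ℝ) (x : ℤ × ℤ) (t : ℝ) : ℝ :=
  (-1 : ℝ) ^ (x.1 + x.2) *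
    (((x.2 : ℝ) ^ 2 - (x.1 : ℝ) ^ 2) ^ 2 *
        (t ^ (q + 2 - 1) * Real.exp (-(((x.1 : ℝ) ^ 2 + (x.2 : ℝ) ^ 2) * t)))
      - 2 * (x.1 : ℝ) ^ 2 *
        (t ^ (q + 1 - 1) * Real.exp (-(((x.1 : ℝ) ^ 2 + (x.2 : ℝ) ^ 2) * t))))

lemma sq_add_sq_pos_of_ne_zero {x : ℤ × ℤ} (hx : x ≠ 0) : 0 < (x.1 : ℝ) ^ 2 + (x.2 : ℝ) ^ 2 := by
  by_contra! h
  have h1 : (x.1 : ℝ) = 0 := by nlinarith [sq_nonneg (x.1 : ℝ), sq_nonneg (x.2 : ℝ)]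
  have h2 : (x.2 : ℝ) = 0 := by nlinarith [sq_nonneg (x.1 : ℝ), sq_nonneg (x.2 : ℝ)]
  exact hx (Prod.ext (by exact_mod_cast h1) (by exact_mod_cast h2))

lemma integrableOn_S2Integrand {q : ℝ} (hq : 1 < q) {x : ℤ × ℤ} (hx : x ≠ 0) :
    IntegrableOn (S2Integrand q x) (Set.Ioi 0) := by
  have hr := sq_add_sq_pos_of_ne_zero hx
  exact (((integrableOn_rpow_mul_exp_neg_mul (by linarith : 0 < q + 2) hr).const_mul _).sub
    ((integrableOn_rpow_mul_exp_neg_mul (by linarith : 0 < q + 1) hr).const_mul _)).const_mul _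

lemma integral_S2Integrand {q : ℝ} (hq : 1 < q) {x : ℤ × ℤ} (hx : x ≠ 0) :
    ∫ t in Set.Ioi 0, S2Integrand q x t = Real.Gamma (q + 1) *
    ((-1 : ℝ) ^ (x.1 + x.2) *
      ((q + 1) * ((x.2 : ℝ) ^ 2 - (x.1 : ℝ) ^ 2) ^ 2
          - 2 * (x.1 : ℝ) ^ 4 - 2 * (x.1 : ℝ) ^ 2 * (x.2 : ℝ) ^ 2)
      / ((x.1 : ℝ) ^ 2 + (x.2 : ℝ) ^ 2) ^ (q + 2)) := by
  have hr := sq_add_sq_pos_of_ne_zero hx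
  have h1 : 0 < q + 1 := by linarith
  have h2 : 0 < q + 2 := by linarith
  simp only [S2Integrand]
  rw [integral_const_mul, integral_sub ((integrableOn_rpow_mul_exp_neg_mul h2 hr).const_mul _)
    ((integrableOn_rpow_mul_exp_neg_mul h1 hr).const_mul _), integral_const_mul,
    integral_const_mul, Real.integral_rpow_mul_exp_neg_mul_Ioi h2 hr,
    Real.integral_rpow_mul_exp_neg_mul_Ioi h1 hr,
    show q + 2 = (q + 1) + 1 by ring, Real.Gamma_add_one h1.ne', one_div,
    Real.rpow_add_one (inv_pos.2 hr).ne', Real.rpow_add_one hr.ne', Real.inv_rpow hr.le]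
  have := Real.rpow_pos_of_pos hr (q + 1)
  field_simp
  ring

lemma integral_norm_S2Integrand_le {q : ℝ} (hq : 1 < q) {x : ℤ × ℤ} (hx : x ≠ 0) :
    ∫ t in Set.Ioi 0, ‖S2Integrand q x t‖ ≤
    (Real.Gamma (q + 2) + 2 * Real.Gamma (q + 1)) *
      ((x.1 : ℝ) ^ 2 + (x.2 : ℝ) ^ 2) ^ (-q) := by
  have hr := sq_add_sq_pos_of_ne_zero hx
  have h1 : 0 < q + 1 := by linarith
  have h2 : 0 < q + 2 := by linarith
  set r := (x.1 : ℝ) ^ 2 + (x.2 : ℝ) ^ 2 with hrdef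
  have i1 := (integrableOn_rpow_mul_exp_neg_mul h2 hr).const_mul (r ^ 2)
  have i2 := (integrableOn_rpow_mul_exp_neg_mul h1 hr).const_mul (2 * r)
  calc ∫ t in Set.Ioi 0, ‖S2Integrand q x t‖
      ≤ ∫ t in Set.Ioi 0, (r ^ 2 * (t ^ (q + 2 - 1) * Real.exp (-(r * t)))
          + 2 * r * (t ^ (q + 1 - 1) * Real.exp (-(r * t)))) := by
        refine setIntegral_mono_on (integrableOn_S2Integrand hq hx).norm (i1.add i2)
          measurableSet_Ioi fun t ht => ?_
        have ht : 0 < t := ht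
        rw [S2Integrand, norm_mul, norm_zpow, norm_neg, norm_one, one_zpow, one_mul]
        refine (norm_sub_le _ _).trans ?_
        rw [Real.norm_of_nonneg (by positivity), Real.norm_of_nonneg (by positivity)]
        gcongr ?_ * _ + 2 * ?_ * _
        · rw [hrdef]; nlinarith [mul_nonneg (sq_nonneg (x.1 : ℝ)) (sq_nonneg (x.2 : ℝ))]
        · rw [hrdef]; linarith [sq_nonneg (x.2 : ℝ)]
    _ = _ := by
      rw [integral_add i1 i2, integral_const_mul, integral_const_mul,
        Real.integral_rpow_mul_exp_neg_mul_Ioi h2 hr,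
        Real.integral_rpow_mul_exp_neg_mul_Ioi h1 hr,
        Real.rpow_neg hr.le, one_div, Real.inv_rpow hr.le, Real.inv_rpow hr.le,
        Real.rpow_add_one hr.ne', show (2 : ℝ) = (2 : ℕ) by norm_num,
        Real.rpow_add_natCast hr.ne']
      have := Real.rpow_pos_of_pos hr q
      push_cast
      field_simp

lemma hasSum_altTheta_mul (i j : ℕ) {t : ℝ} (ht : 0 < t) :
    HasSum (fun x : ℤ × ℤ => (-1 : ℝ) ^ (x.1 + x.2) * (((x.1 : ℝ) ^ 2) ^ i * ((x.2 : ℝ) ^ 2) ^ j *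
      Real.exp (-(((x.1 : ℝ) ^ 2 + (x.2 : ℝ) ^ 2) * t)))) (altTheta i t * altTheta j t) := by
  have h := (summable_altTheta i ht).hasSum.mul (summable_altTheta j ht).hasSum
    (summable_mul_of_summable_norm (summable_altTheta i ht).norm (summable_altTheta j ht).norm)
  refine h.congr_fun fun x => ?_
  rw [zpow_add₀ (by norm_num), add_mul, neg_add, Real.exp_add, mul_comm t, mul_comm t]
  ring

lemma tsum_S2Integrand (q : ℝ) {t : ℝ} (ht : 0 < t) :
    ∑' x : {x : ℤ × ℤ // x ≠ 0}, S2Integrand q x t = 2 * t ^ (q - 1) *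
      (t ^ 2 * (altTheta 2 t * altTheta 0 t - altTheta 1 t ^ 2)
        - t * (altTheta 1 t * altTheta 0 t)) := by
  have h := (((((hasSum_altTheta_mul 0 2 ht).add (hasSum_altTheta_mul 2 0 ht)).sub
    ((hasSum_altTheta_mul 1 1 ht).mul_left 2)).mul_left (t ^ (q - 1) * t ^ 2)).sub
    ((hasSum_altTheta_mul 1 0 ht).mul_left (2 * (t ^ (q - 1) * t))))
  have e1 : t ^ (q + 1 - 1) = t ^ (q - 1) * t := by
    rw [← Real.rpow_add_one ht.ne']; ring_nf
  have e2 : t ^ (q + 2 - 1) = t ^ (q - 1) * t ^ 2 := by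
    rw [← Real.rpow_add_natCast ht.ne']; push_cast; ring_nf
  have h' := h.congr_fun (g := fun x => S2Integrand q x t) fun x => by
    rw [S2Integrand, e1, e2]
    ring
  have hsupp : Function.support (fun x => S2Integrand q x t) ⊆ {x | x ≠ 0} := by
    rintro x hx rfl
    simp [S2Integrand] at hx
  refine ((hasSum_subtype_iff_of_support_subset hsupp).2 h').tsum_eq.trans ?_
  ring

/-- For every `q > 1`, the sum defining `S₂(q)` converges absolutely and
`S₂(q) < 0`. -/
theorem S2_summable_neg (q : ℝ) (hq : 1 < q) :
    Summable (fun x : {x : ℤ × ℤ // x ≠ 0} =>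
      (-1 : ℝ) ^ (x.1.1 + x.1.2) *
        ((q + 1) * ((x.1.2 : ℝ) ^ 2 - (x.1.1 : ℝ) ^ 2) ^ 2
            - 2 * (x.1.1 : ℝ) ^ 4 - 2 * (x.1.1 : ℝ) ^ 2 * (x.1.2 : ℝ) ^ 2)
        / ((x.1.1 : ℝ) ^ 2 + (x.1.2 : ℝ) ^ 2) ^ (q + 2)) ∧
    S2 q < 0 := by
  have hint (x : {x : ℤ × ℤ // x ≠ 0}) :
      Integrable (S2Integrand q x) (volume.restrict (Set.Ioi 0)) :=
    integrableOn_S2Integrand hq x.2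
  have hsum : Summable fun x : {x : ℤ × ℤ // x ≠ 0} =>
      ∫ t in Set.Ioi 0, ‖S2Integrand q x t‖ :=
    .of_nonneg_of_le (fun x => integral_nonneg fun t => norm_nonneg _)
      (fun x => integral_norm_S2Integrand_le hq x.2)
      (((summable_sq_add_sq_rpow hq).subtype _).mul_left _)
  have hG : 0 < Real.Gamma (q + 1) := Real.Gamma_pos_of_pos (by linarith)
  have hs := hasSum_integral_of_summable_integral_norm hint hsum
  simp only [fun x : {x : ℤ × ℤ // x ≠ 0} => integral_S2Integrand hq x.2] at hs
  have hmeas : AEStronglyMeasurable (fun t => ∑' x : {x : ℤ × ℤ // x ≠ 0}, S2Integrand q x t)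
      (volume.restrict (Set.Ioi 0)) := by
    refine ContinuousOn.aestronglyMeasurable (ContinuousOn.congr ?_ fun t ht =>
      tsum_S2Integrand q ht) measurableSet_Ioi
    have hc (k : ℕ) : ContinuousOn (altTheta k) (Set.Ioi 0) := fun t ht =>
      (hasDerivAt_altTheta k ht).continuousAt.continuousWithinAt
    have hr : ContinuousOn (fun t : ℝ => t ^ (q - 1)) (Set.Ioi 0) :=
      continuousOn_id.rpow_const fun t ht => Or.inl (ne_of_gt ht)
    fun_prop
  have hI := integrable_tsum_of_summable_integral_norm hint hsum hmeas
  have hneg {t : ℝ} (ht : t ∈ Set.Ioi (0 : ℝ)) :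
      ∑' x : {x : ℤ × ℤ // x ≠ 0}, S2Integrand q x t < 0 := by
    have ht : 0 < t := ht
    rw [tsum_S2Integrand q ht]
    exact mul_neg_of_pos_of_neg (by positivity) (altTheta_mul_lt ht)
  have hlt : 0 < ∫ t in Set.Ioi 0, -∑' x : {x : ℤ × ℤ // x ≠ 0}, S2Integrand q x t := by
    refine (setIntegral_pos_iff_support_of_nonneg_ae ?_ hI.neg).2 ?_
    · filter_upwards [self_mem_ae_restrict measurableSet_Ioi] with t ht
      exact (neg_pos.2 (hneg ht)).le
    · have hsub : Set.Ioi 0 ⊆ Function.support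
          fun t => -∑' x : {x : ℤ × ℤ // x ≠ 0}, S2Integrand q x t :=
        fun t ht => (neg_pos.2 (hneg ht)).ne'
      change 0 < volume ((Function.support
        fun t => -∑' x : {x : ℤ × ℤ // x ≠ 0}, S2Integrand q x t) ∩ Set.Ioi 0)
      rw [Set.inter_eq_right.2 hsub, Real.volume_Ioi]
      exact ENNReal.zero_lt_top
  rw [integral_neg, neg_pos, ← hs.tsum_eq, tsum_mul_left] at hlt
  exact ⟨(summable_mul_left_iff hG.ne').1 hs.summable,
    mul_neg_of_pos_of_neg (by linarith) (neg_of_mul_neg_right hlt hG.le)⟩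
end
end

section
/- Let β > α > 0 and, for V > 0 and y > 0, define F_V(y) = θ₃(βVy)·θ₃(βV/y) + θ₄(αVy)·θ₄(αV/y). There exists V₁ > 0 (depending on α and β) such that for every V > V₁: (a) y = 1 is a strict local maximum of F_V on (0,∞), and (b) there exists y > 0 with F_V(y) < F_V(1); in particular, the square lattice is not a minimizer of the alternating-charge Gaussian energy among two-dimensional rectangular lattices of covolume V. -/
noncomputable section

/-- Jacobi theta function `θ₃(x) = Σ_{k∈ℤ} e^{-πxk²}`. -/
def theta3 (x : ℝ) : ℝ := ∑' k : ℤ, Real.exp (-Real.pi * x * (k : ℝ) ^ 2)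

/-- Jacobi theta function `θ₄(x) = Σ_{k∈ℤ} (-1)^k e^{-πxk²}`. -/
def theta4 (x : ℝ) : ℝ := ∑' k : ℤ, (-1 : ℝ) ^ k * Real.exp (-Real.pi * x * (k : ℝ) ^ 2)

/-- `F_{α,β,V}(y) = θ₃(βVy)θ₃(βV/y) + θ₄(αVy)θ₄(αV/y)`, the (shifted)
alternating-charge Gaussian energy of the rectangular lattice
`√(Vy)ℤ × √(V/y)ℤ`. -/
def FV (α β V y : ℝ) : ℝ :=
  theta3 (β * V * y) * theta3 (β * V / y) + theta4 (α * V * y) * theta4 (α * V / y)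

open Filter Topology Set

/-- The `j`-th termwise derivative of the theta-like series `Σ_{k∈ℤ} s_k e^{-πxk²}`. -/
def weightedTheta (s : ℤ → ℝ) (j : ℕ) (x : ℝ) : ℝ :=
  ∑' k : ℤ, s k * (-Real.pi * (k : ℝ) ^ 2) ^ j * Real.exp (-Real.pi * x * (k : ℝ) ^ 2)

theorem summable_pow_mul_exp_neg_sq (j : ℕ) {x : ℝ} (hx : 0 < x) :
    Summable fun k : ℤ =>
      (Real.pi * (k : ℝ) ^ 2) ^ j * Real.exp (-Real.pi * x * (k : ℝ) ^ 2) := by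
  refine ((summable_pow_mul_jacobiTheta₂_term_bound 0 hx (2 * j)).mul_left
    (Real.pi ^ j)).congr fun k => ?_
  rw [pow_mul, Int.cast_abs, sq_abs, mul_pow]
  ring_nf

theorem norm_weighted_term_le {s : ℤ → ℝ} (hs : ∀ k, |s k| ≤ 1) (j : ℕ) {x y : ℝ}
    (hxy : x ≤ y) (k : ℤ) :
    ‖s k * (-Real.pi * (k : ℝ) ^ 2) ^ j * Real.exp (-Real.pi * y * (k : ℝ) ^ 2)‖ ≤
      (Real.pi * (k : ℝ) ^ 2) ^ j * Real.exp (-Real.pi * x * (k : ℝ) ^ 2) := by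
  have hpi := Real.pi_pos
  have hbase : |(-Real.pi * (k : ℝ) ^ 2)| = Real.pi * (k : ℝ) ^ 2 := by
    rw [neg_mul, abs_neg, abs_of_nonneg (by positivity)]
  rw [norm_mul, norm_mul, norm_pow, Real.norm_eq_abs, Real.norm_eq_abs, Real.norm_eq_abs,
    hbase, Real.abs_exp]
  have hexp : Real.exp (-Real.pi * y * (k : ℝ) ^ 2) ≤ Real.exp (-Real.pi * x * (k : ℝ) ^ 2) := by
    refine Real.exp_le_exp.2 ?_
    have : Real.pi * (k : ℝ) ^ 2 * x ≤ Real.pi * (k : ℝ) ^ 2 * y := by gcongr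
    linarith
  have hp : 0 ≤ (Real.pi * (k : ℝ) ^ 2) ^ j := by positivity
  refine mul_le_mul (mul_le_of_le_one_left hp (hs k)) hexp (Real.exp_nonneg _) hp

theorem hasDerivAt_weightedTheta {s : ℤ → ℝ} (hs : ∀ k, |s k| ≤ 1) (j : ℕ) {x : ℝ}
    (hx : 0 < x) : HasDerivAt (weightedTheta s j) (weightedTheta s (j + 1) x) x := by
  have hx2 : x ∈ Ioi (x / 2) := half_lt_self hx
  refine hasDerivAt_tsum_of_isPreconnected
    (summable_pow_mul_exp_neg_sq (j + 1) (half_pos hx)) isOpen_Ioi isPreconnected_Ioi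
    (fun k y _ => ?_) (fun k y hy => norm_weighted_term_le hs (j + 1) (mem_Ioi.1 hy).le k) hx2
    ((summable_pow_mul_exp_neg_sq j hx).of_norm_bounded
      fun k => norm_weighted_term_le hs j le_rfl k) hx2
  have h : HasDerivAt (fun z : ℝ => -Real.pi * z * (k : ℝ) ^ 2) (-Real.pi * (k : ℝ) ^ 2) y := by
    simpa using ((hasDerivAt_id y).const_mul (-Real.pi)).mul_const ((k : ℝ) ^ 2)
  convert! h.exp.const_mul (s k * (-Real.pi * (k : ℝ) ^ 2) ^ j) using 1
  ring

theorem tendsto_weightedTheta_zero {s : ℤ → ℝ} (hs : ∀ k, |s k| ≤ 1) :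
    Tendsto (weightedTheta s 0) atTop (𝓝 (s 0)) := by
  have hsum : ∑' k : ℤ, (if k = 0 then s 0 else 0) = s 0 := tsum_ite_eq 0 _
  rw [← hsum]
  refine tendsto_tsum_of_dominated_convergence
    (summable_pow_mul_exp_neg_sq 0 one_pos) (fun k => ?_) ?_
  · by_cases hk : k = 0
    · subst hk
      simp
    · have hk2 : (0 : ℝ) < Real.pi * (k : ℝ) ^ 2 := by positivity
      have h : Tendsto (fun x : ℝ => Real.exp (-(Real.pi * (k : ℝ) ^ 2 * x))) atTop (𝓝 0) :=
        Real.tendsto_exp_neg_atTop_nhds_zero.comp (tendsto_id.const_mul_atTop hk2)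
      have h' := h.const_mul (s k)
      simp only [hk, if_false]
      rw [mul_zero] at h'
      refine h'.congr fun x => ?_
      rw [pow_zero, mul_one]
      ring_nf
  · filter_upwards [eventually_ge_atTop 1] with x hx k
    exact norm_weighted_term_le hs 0 hx k

theorem tendsto_exp_mul_weightedTheta_succ {s : ℤ → ℝ} (hs : ∀ k, |s k| ≤ 1) (j : ℕ) :
    Tendsto (fun x => Real.exp (Real.pi * x) * weightedTheta s (j + 1) x) atTop
      (𝓝 ((s 1 + s (-1)) * (-Real.pi) ^ (j + 1))) := by
  have hsum : ∑' k : ℤ, (if k ∈ ({1, -1} : Finset ℤ) then s k * (-Real.pi) ^ (j + 1) else 0) =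
      (s 1 + s (-1)) * (-Real.pi) ^ (j + 1) := by
    rw [tsum_eq_sum (s := ({1, -1} : Finset ℤ)) fun k hk => if_neg hk, Finset.sum_pair (by decide)]
    simp [add_mul]
  rw [← hsum]
  simp_rw [weightedTheta, ← tsum_mul_left]
  refine tendsto_tsum_of_dominated_convergence
    ((summable_pow_mul_exp_neg_sq (j + 1) one_pos).mul_left (Real.exp (Real.pi * 1)))
    (fun k => ?_) ?_
  · have hrw : ∀ x : ℝ, Real.exp (Real.pi * x) * (s k * (-Real.pi * (k : ℝ) ^ 2) ^ (j + 1) *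
        Real.exp (-Real.pi * x * (k : ℝ) ^ 2)) = s k * (-Real.pi * (k : ℝ) ^ 2) ^ (j + 1) *
        Real.exp (-(Real.pi * ((k : ℝ) ^ 2 - 1) * x)) := fun x => by
      rw [mul_left_comm, ← Real.exp_add]
      ring_nf
    simp_rw [hrw]
    by_cases hk : k ∈ ({1, -1} : Finset ℤ)
    · have hk2 : (k : ℝ) ^ 2 = 1 := by
        simp only [Finset.mem_insert, Finset.mem_singleton] at hk
        rcases hk with rfl | rfl <;> norm_num
      simp [hk, hk2]
    · rw [if_neg hk]
      by_cases hk0 : k = 0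
      · simp [hk0]
      have hk2 : (1 : ℝ) < (k : ℝ) ^ 2 := by
        simp only [Finset.mem_insert, Finset.mem_singleton, not_or] at hk
        rw [one_lt_sq_iff_one_lt_abs]
        have : 1 < |k| := by grind
        exact_mod_cast this
      have h : Tendsto (fun x : ℝ => Real.exp (-(Real.pi * ((k : ℝ) ^ 2 - 1) * x))) atTop (𝓝 0) :=
        Real.tendsto_exp_neg_atTop_nhds_zero.comp
          (tendsto_id.const_mul_atTop (mul_pos Real.pi_pos (sub_pos.2 hk2)))
      simpa only [mul_zero] using h.const_mul (s k * (-Real.pi * (k : ℝ) ^ 2) ^ (j + 1))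
  · filter_upwards [eventually_ge_atTop 1] with x hx k
    have hpi := Real.pi_pos
    by_cases hk0 : k = 0
    · simp [hk0]
    have hk2 : (1 : ℝ) ≤ (k : ℝ) ^ 2 := by
      rw [one_le_sq_iff_one_le_abs]
      exact_mod_cast Int.one_le_abs hk0
    have hb := norm_weighted_term_le hs (j + 1) (le_refl x) k
    rw [norm_mul, Real.norm_eq_abs, Real.abs_exp]
    refine (mul_le_mul_of_nonneg_left hb (Real.exp_nonneg _)).trans ?_
    rw [mul_left_comm, mul_left_comm (Real.exp (Real.pi * 1)), ← Real.exp_add, ← Real.exp_add]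
    refine mul_le_mul_of_nonneg_left (Real.exp_le_exp.2 ?_) (by positivity)
    have : 0 ≤ Real.pi * ((x - 1) * ((k : ℝ) ^ 2 - 1)) :=
      mul_nonneg hpi.le (mul_nonneg (sub_nonneg.2 hx) (sub_nonneg.2 hk2))
    linarith

/-- The second derivative at `y = 1` of `y ↦ φ(xy)φ(x/y)`, where `φ = weightedTheta s 0`. -/
def productSecondDeriv (s : ℤ → ℝ) (x : ℝ) : ℝ :=
  2 * x ^ 2 * (weightedTheta s 0 x * weightedTheta s 2 x) - 2 * x ^ 2 * weightedTheta s 1 x ^ 2 +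
    2 * x * (weightedTheta s 0 x * weightedTheta s 1 x)

/-- The derivative of `y ↦ φ(xy)φ(x/y)`, where `φ = weightedTheta s 0`. -/
def productDeriv (s : ℤ → ℝ) (x y : ℝ) : ℝ :=
  x * (weightedTheta s 1 (x * y) * weightedTheta s 0 (x / y)) -
    x / y ^ 2 * (weightedTheta s 0 (x * y) * weightedTheta s 1 (x / y))

theorem hasDerivAt_weightedTheta_mul {s : ℤ → ℝ} (hs : ∀ k, |s k| ≤ 1) (j : ℕ) {x y : ℝ}
    (hx : 0 < x) (hy : 0 < y) :
    HasDerivAt (fun z => weightedTheta s j (x * z)) (weightedTheta s (j + 1) (x * y) * x) y :=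
  (hasDerivAt_weightedTheta hs j (mul_pos hx hy)).comp y
    (by simpa using (hasDerivAt_id y).const_mul x)

theorem hasDerivAt_weightedTheta_div {s : ℤ → ℝ} (hs : ∀ k, |s k| ≤ 1) (j : ℕ) {x y : ℝ}
    (hx : 0 < x) (hy : 0 < y) :
    HasDerivAt (fun z => weightedTheta s j (x / z))
      (weightedTheta s (j + 1) (x / y) * -(x / y ^ 2)) y := by
  refine (hasDerivAt_weightedTheta hs j (div_pos hx hy)).comp y ?_
  convert! (hasDerivAt_inv hy.ne').const_mul x using 1
  field_simp

theorem hasDerivAt_product {s : ℤ → ℝ} (hs : ∀ k, |s k| ≤ 1) {x y : ℝ}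
    (hx : 0 < x) (hy : 0 < y) :
    HasDerivAt (fun z => weightedTheta s 0 (x * z) * weightedTheta s 0 (x / z))
      (productDeriv s x y) y := by
  convert! (hasDerivAt_weightedTheta_mul hs 0 hx hy).mul
    (hasDerivAt_weightedTheta_div hs 0 hx hy) using 1
  simp only [productDeriv]
  ring

theorem hasDerivAt_productDeriv {s : ℤ → ℝ} (hs : ∀ k, |s k| ≤ 1) {x : ℝ} (hx : 0 < x) :
    HasDerivAt (productDeriv s x) (productSecondDeriv s x) 1 := by
  have hsq : HasDerivAt (fun z : ℝ => x / z ^ 2) (-2 * x) 1 := by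
    convert! (((hasDerivAt_id (1 : ℝ)).pow 2).inv (by simp)).const_mul x using 1
    norm_num
    ring
  have hm := fun j => hasDerivAt_weightedTheta_mul hs j hx one_pos
  have hd := fun j => hasDerivAt_weightedTheta_div hs j hx one_pos
  convert! (((hm 1).mul (hd 0)).const_mul x).sub (hsq.mul ((hm 0).mul (hd 1))) using 1
  simp only [productSecondDeriv, mul_one, div_one, one_pow, Pi.mul_apply]
  ring

theorem tendsto_productSecondDeriv {s : ℤ → ℝ} (hs : ∀ k, |s k| ≤ 1) :
    Tendsto (fun x => Real.exp (Real.pi * x) / x ^ 2 * productSecondDeriv s x) atTop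
      (𝓝 (2 * (s 0 * ((s 1 + s (-1)) * Real.pi ^ 2)))) := by
  have h0 := tendsto_weightedTheta_zero hs
  have h1 := tendsto_exp_mul_weightedTheta_succ hs 0
  have h2 := tendsto_exp_mul_weightedTheta_succ hs 1
  have he : Tendsto (fun x : ℝ => Real.exp (-(Real.pi * x))) atTop (𝓝 0) :=
    Real.tendsto_exp_neg_atTop_nhds_zero.comp (tendsto_id.const_mul_atTop Real.pi_pos)
  have hlim := (((h0.mul h2).const_mul 2).sub ((he.mul (h1.pow 2)).const_mul 2)).add
    ((tendsto_inv_atTop_zero.mul (h0.mul h1)).const_mul 2)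
  convert! hlim.congr' ?_ using 2
  · ring
  · filter_upwards [eventually_gt_atTop 0] with x hx
    have hexp : Real.exp (-(Real.pi * x)) * Real.exp (Real.pi * x) = 1 := by
      rw [← Real.exp_add]
      simp
    simp only [productSecondDeriv, zero_add, Nat.reduceAdd]
    field_simp
    linear_combination (-x * weightedTheta s 1 x ^ 2) * hexp

theorem strict_local_max_of_hasDerivAt {f f' : ℝ → ℝ} {a D : ℝ}
    (hf : ∀ᶠ y in 𝓝 a, HasDerivAt f (f' y) y) (hf' : HasDerivAt f' D a) (ha : f' a = 0)
    (hD : D < 0) : ∃ δ : ℝ, 0 < δ ∧ ∀ y : ℝ, |y - a| < δ → y ≠ a → f y < f a := by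
  have hslope : ∀ᶠ y in 𝓝[≠] a, slope f' a y < 0 :=
    (hasDerivAt_iff_tendsto_slope.1 hf').eventually_lt_const hD
  rw [eventually_nhdsWithin_iff] at hslope
  obtain ⟨δ, hδ, h⟩ := Metric.eventually_nhds_iff.1 (hf.and hslope)
  refine ⟨δ, hδ, fun y hy hya => ?_⟩
  have hdist : ∀ z ∈ uIcc a y, dist z a < δ := fun z hz =>
    (abs_sub_left_of_mem_uIcc hz).trans_lt hy
  rcases lt_or_gt_of_ne hya with hlt | hgt
  · rw [uIcc_of_ge hlt.le] at hdist
    refine strictMonoOn_of_deriv_pos (convex_Icc y a)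
      (fun z hz => (h (hdist z hz)).1.continuousAt.continuousWithinAt) (fun z hz => ?_)
      (left_mem_Icc.2 hlt.le) (right_mem_Icc.2 hlt.le) hlt
    rw [interior_Icc] at hz
    have hz' := h (hdist z (Ioo_subset_Icc_self hz))
    have hs := hz'.2 hz.2.ne
    rw [slope_def_field, ha, sub_zero, div_neg_iff] at hs
    rw [hz'.1.deriv]
    have := hz.2
    rcases hs with hs | hs <;> linarith
  · rw [uIcc_of_le hgt.le] at hdist
    refine strictAntiOn_of_deriv_neg (convex_Icc a y)
      (fun z hz => (h (hdist z hz)).1.continuousAt.continuousWithinAt) (fun z hz => ?_)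
      (left_mem_Icc.2 hgt.le) (right_mem_Icc.2 hgt.le) hgt
    rw [interior_Icc] at hz
    have hz' := h (hdist z (Ioo_subset_Icc_self hz))
    have hs := hz'.2 hz.1.ne'
    rw [slope_def_field, ha, sub_zero, div_neg_iff] at hs
    rw [hz'.1.deriv]
    have := hz.1
    rcases hs with hs | hs <;> linarith

theorem theta3_eq_weightedTheta : theta3 = weightedTheta (fun _ => 1) 0 := by
  funext x
  simp [theta3, weightedTheta]

theorem theta4_eq_weightedTheta : theta4 = weightedTheta (fun k => (-1) ^ k) 0 := by
  funext x
  simp [theta4, weightedTheta]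

theorem eventually_productSecondDeriv_add_neg {s t : ℤ → ℝ} (hs : ∀ k, |s k| ≤ 1)
    (ht : ∀ k, |t k| ≤ 1) (hneg : t 0 * (t 1 + t (-1)) < 0) {α β : ℝ} (hα : 0 < α)
    (hαβ : α < β) :
    ∀ᶠ V in atTop, productSecondDeriv s (β * V) + productSecondDeriv t (α * V) < 0 := by
  have hβ : 0 < β := hα.trans hαβ
  have h3 := (tendsto_productSecondDeriv hs).comp (tendsto_id.const_mul_atTop hβ)
  have h4 := (tendsto_productSecondDeriv ht).comp (tendsto_id.const_mul_atTop hα)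
  have he : Tendsto (fun V : ℝ => Real.exp (-(Real.pi * (β - α) * V))) atTop (𝓝 0) :=
    Real.tendsto_exp_neg_atTop_nhds_zero.comp
      (tendsto_id.const_mul_atTop (mul_pos Real.pi_pos (sub_pos.2 hαβ)))
  have hlim := ((he.mul h3).const_mul ((β / α) ^ 2)).add h4
  have hlt : (β / α) ^ 2 * (0 * (2 * (s 0 * ((s 1 + s (-1)) * Real.pi ^ 2)))) +
      2 * (t 0 * ((t 1 + t (-1)) * Real.pi ^ 2)) < 0 := by
    nlinarith [mul_neg_of_neg_of_pos hneg (pow_pos Real.pi_pos 2)]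
  filter_upwards [hlim.eventually_lt_const hlt, eventually_gt_atTop 0] with V hV hV0
  have hpos : 0 < Real.exp (Real.pi * (α * V)) / (α * V) ^ 2 := by positivity
  refine neg_of_mul_neg_right (a := Real.exp (Real.pi * (α * V)) / (α * V) ^ 2) (lt_of_eq_of_lt ?_ hV) hpos.le
  have hexp : Real.exp (Real.pi * (α * V)) =
      Real.exp (-(Real.pi * (β - α) * V)) * Real.exp (Real.pi * (β * V)) := by
    rw [← Real.exp_add]
    ring_nf
  simp only [Function.comp_apply, id, mul_add]
  congr 1
  rw [hexp]
  field_simp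

/-- For all sufficiently large `V`, the square lattice is a strict local maximum
of the alternating-charge Gaussian energy among rectangular lattices of
covolume `V`, and it is not a minimizer. -/
theorem square_not_minimizer_large_V (α β : ℝ) (hα : 0 < α) (hαβ : α < β) :
    ∃ V₁ : ℝ, 0 < V₁ ∧ ∀ V : ℝ, V > V₁ →
      (∃ δ : ℝ, 0 < δ ∧ ∀ y : ℝ, 0 < y → |y - 1| < δ → y ≠ 1 →
        FV α β V y < FV α β V 1) ∧
      (∃ y : ℝ, 0 < y ∧ FV α β V y < FV α β V 1) := by
  have hs3 : ∀ k : ℤ, |(fun _ : ℤ => (1 : ℝ)) k| ≤ 1 := fun _ => by simp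
  have hs4 : ∀ k : ℤ, |(fun k : ℤ => (-1 : ℝ) ^ k) k| ≤ 1 := fun k => by simp [abs_zpow]
  obtain ⟨V₀, hV₀⟩ := eventually_atTop.1
    (eventually_productSecondDeriv_add_neg hs3 hs4 (by norm_num) hα hαβ)
  refine ⟨max V₀ 1, by positivity, fun V hV => ?_⟩
  have hVpos : 0 < V := one_pos.trans ((le_max_right _ _).trans_lt hV)
  have h3 : 0 < β * V := mul_pos (hα.trans hαβ) hVpos
  have h4 : 0 < α * V := mul_pos hα hVpos
  have hderiv : ∀ᶠ y in 𝓝 (1 : ℝ), HasDerivAt (FV α β V) (productDeriv (fun _ => 1) (β * V) y +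
      productDeriv (fun k => (-1) ^ k) (α * V) y) y := by
    filter_upwards [lt_mem_nhds one_pos] with y hy
    have h := (hasDerivAt_product hs3 h3 hy).add (hasDerivAt_product hs4 h4 hy)
    rwa [← theta3_eq_weightedTheta, ← theta4_eq_weightedTheta] at h
  obtain ⟨δ, hδ, hmax⟩ := strict_local_max_of_hasDerivAt hderiv
    ((hasDerivAt_productDeriv hs3 h3).add (hasDerivAt_productDeriv hs4 h4))
    (by simp only [productDeriv, mul_one, div_one, one_pow]; ring)
    (hV₀ V ((le_max_left _ _).trans hV.le))
  refine ⟨⟨δ, hδ, fun y _ => hmax y⟩, 1 + δ / 2, by positivity, hmax _ ?_ (by simp [hδ.ne'])⟩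
  rw [add_sub_cancel_left, abs_of_pos (half_pos hδ)]
  exact half_lt_self hδ
end
end

section
/- Let d ≥ 1, let s > d, and let a = (a₁,…,a_d) ∈ (0,∞)^d. Then the alternating Epstein zeta sum of the orthorhombic lattice L_a is strictly negative: Σ_{n∈ℤ^d∖{0}} (−1)^{n₁+⋯+n_d} (a₁²n₁² + ⋯ + a_d²n_d²)^{−s/2} < 0 (the sum converges absolutely since s > d). -/
noncomputable section

/-- Quadratic form of the orthorhombic lattice `L_a = a₁ℤ × ⋯ × a_dℤ`:
`Q_a(n) = a₁²n₁² + ⋯ + a_d²n_d²`. -/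
def Qf (d : ℕ) (a : Fin d → ℝ) (n : Fin d → ℤ) : ℝ :=
  ∑ i, (a i) ^ 2 * (n i : ℝ) ^ 2

open MeasureTheory Set Filter

/-- The term of index `k` of the theta series `∑ (-1)ᵏ exp (-u k²)`. -/
def altThetaTerm (u : ℝ) (k : ℤ) : ℝ := (-1) ^ k * Real.exp (-(u * (k : ℝ) ^ 2))

lemma summable_exp_neg_mul_nat_sq {u : ℝ} (hu : 0 < u) :
    Summable fun n : ℕ ↦ Real.exp (-(u * (n : ℝ) ^ 2)) := by
  refine Summable.of_nonneg_of_le (fun _ ↦ (Real.exp_pos _).le) (fun n ↦ ?_)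
    (Real.summable_exp_nat_mul_iff.2 (neg_lt_zero.2 hu))
  rw [Real.exp_le_exp, mul_neg, neg_le_neg_iff, mul_comm]
  have h : (n : ℝ) ≤ (n : ℝ) ^ 2 := by exact_mod_cast Nat.le_self_pow two_ne_zero n
  gcongr

lemma summable_neg_one_pow_mul_exp_neg_mul_nat_sq {u : ℝ} (hu : 0 < u) :
    Summable fun n : ℕ ↦ (-1 : ℝ) ^ n * Real.exp (-(u * (n : ℝ) ^ 2)) :=
  Summable.of_norm (by simpa [abs_mul] using summable_exp_neg_mul_nat_sq hu)

lemma hasSum_altThetaTerm {u : ℝ} (hu : 0 < u) :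
    HasSum (altThetaTerm u)
      (2 * (∑' n : ℕ, (-1 : ℝ) ^ n * Real.exp (-(u * (n : ℝ) ^ 2))) - 1) := by
  have hs := summable_neg_one_pow_mul_exp_neg_mul_nat_sq hu
  have h1 : HasSum (fun n : ℕ ↦ altThetaTerm u n)
      (∑' n : ℕ, (-1 : ℝ) ^ n * Real.exp (-(u * (n : ℝ) ^ 2))) := by
    simpa [altThetaTerm] using hs.hasSum
  have h2 : HasSum (fun n : ℕ ↦ altThetaTerm u (-n))
      (∑' n : ℕ, (-1 : ℝ) ^ n * Real.exp (-(u * (n : ℝ) ^ 2))) := by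
    simpa [altThetaTerm, zpow_neg, ← inv_pow, inv_neg] using hs.hasSum
  have h := HasSum.of_nat_of_neg h1 h2
  rwa [show altThetaTerm u 0 = 1 by simp [altThetaTerm], ← two_mul] at h

lemma abs_tsum_altThetaTerm_lt_one {u : ℝ} (hu : 0 < u) : |∑' k, altThetaTerm u k| < 1 := by
  rw [(hasSum_altThetaTerm hu).tsum_eq]
  have hs := summable_neg_one_pow_mul_exp_neg_mul_nat_sq hu
  have ht := hs.hasSum.tendsto_sum_nat
  have hanti : Antitone fun n : ℕ ↦ Real.exp (-(u * (n : ℝ) ^ 2)) := by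
    intro m n hmn
    dsimp only
    gcongr
  have hlow := hanti.alternating_series_le_tendsto ht 1
  have hupp := hanti.tendsto_le_alternating_series ht 1
  simp only [Finset.sum_range_succ, Finset.sum_range_zero, mul_one] at hlow hupp
  norm_num at hlow hupp
  have e1 : Real.exp (-u) < 1 := Real.exp_lt_one_iff.mpr (by linarith)
  have e2 : Real.exp (-(u * 4)) < Real.exp (-u) := Real.exp_lt_exp.2 (by linarith)
  rw [abs_lt]
  constructor <;> linarith

lemma summable_norm_altThetaTerm {u : ℝ} (hu : 0 < u) :
    Summable fun k ↦ ‖altThetaTerm u k‖ :=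
  (hasSum_altThetaTerm hu).summable.norm

lemma hasSum_pi_prod_of_summable_norm {α : Type*} :
    ∀ {d : ℕ} {f : Fin d → α → ℝ}, (∀ i, Summable fun k ↦ ‖f i k‖) →
      (Summable fun n : Fin d → α ↦ ‖∏ i, f i (n i)‖) ∧
        HasSum (fun n : Fin d → α ↦ ∏ i, f i (n i)) (∏ i, ∑' k, f i k)
  | 0, _, _ => by
    refine ⟨(hasSum_unique _).summable, ?_⟩
    simp [hasSum_unique]
  | d + 1, f, hf => by
    obtain ⟨hs, hh⟩ := hasSum_pi_prod_of_summable_norm (fun i : Fin d ↦ hf i.succ)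
    have h0 := hf 0
    let e := Fin.consEquiv fun _ : Fin (d + 1) ↦ α
    have hs' := h0.mul_norm hs
    refine ⟨?_, ?_⟩
    · rw [← e.summable_iff]
      simpa [Function.comp_def, e, Fin.consEquiv, Fin.prod_univ_succ] using hs'
    · rw [← e.hasSum_iff, Fin.prod_univ_succ]
      simpa [Function.comp_def, e, Fin.consEquiv, Fin.prod_univ_succ] using
        h0.of_norm.hasSum.mul hh hs'.of_norm

lemma summable_norm_int_rpow {d : ℕ} {s : ℝ} (hs : (d : ℝ) < s) :
    Summable fun n : Fin d → ℤ ↦ ‖n‖ ^ (-s) := by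
  let b := Pi.basisFun ℝ (Fin d)
  let L := Submodule.span ℤ (range b)
  have hrank : Module.finrank ℤ L = d := by
    rw [Module.finrank_eq_card_basis (b.restrictScalars ℤ), Fintype.card_fin]
  have h := ZLattice.summable_norm_rpow L (-s) (by rw [hrank]; linarith)
  have hmem (n : Fin d → ℤ) : (fun i ↦ (n i : ℝ)) ∈ L := by
    rw [b.mem_span_iff_repr_mem ℤ]
    intro i
    simp [b]
  let φ : (Fin d → ℤ) → L := fun n ↦ ⟨fun i ↦ (n i : ℝ), hmem n⟩
  have hφ : Function.Injective φ := by
    intro m n hmn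
    ext i
    exact Int.cast_injective (α := ℝ) (congrFun (congrArg Subtype.val hmn) i)
  refine (h.comp_injective hφ).congr fun n ↦ ?_
  have : ‖φ n‖ = ‖n‖ := by
    rw [Submodule.coe_norm]
    have (k : ℤ) : ‖(k : ℝ)‖₊ = ‖k‖₊ := NNReal.eq (Int.norm_cast_real k)
    simp only [φ, Pi.norm_def, this]
  simp only [Function.comp_apply, this]

section Qf

variable {d : ℕ} {a : Fin d → ℝ}

lemma exists_mul_norm_sq_le_Qf (ha : ∀ i, 0 < a i) :
    ∃ c > 0, ∀ n, (c * ‖n‖) ^ 2 ≤ Qf d a n := by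
  rcases isEmpty_or_nonempty (Fin d) with h | h
  · exact ⟨1, one_pos, fun n ↦ by simp [Qf, Subsingleton.elim n 0]⟩
  obtain ⟨j, hj⟩ := Finite.exists_min a
  refine ⟨a j, ha j, fun n ↦ ?_⟩
  obtain ⟨i, hi⟩ : ∃ i, ‖n i‖ = ‖n‖ := by
    obtain ⟨i, -, hi⟩ := Finset.exists_mem_eq_sup Finset.univ Finset.univ_nonempty
      fun i ↦ ‖n i‖₊
    exact ⟨i, by rw [Pi.norm_def, hi, coe_nnnorm]⟩
  calc (a j * ‖n‖) ^ 2 = a j ^ 2 * (n i : ℝ) ^ 2 := by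
        rw [← hi, Int.norm_eq_abs, mul_pow, sq_abs]
    _ ≤ a i ^ 2 * (n i : ℝ) ^ 2 := by
        have := (ha j).le
        gcongr
        exact hj i
    _ ≤ Qf d a n := Finset.single_le_sum (f := fun i ↦ a i ^ 2 * (n i : ℝ) ^ 2)
        (fun i _ ↦ by positivity) (Finset.mem_univ i)

lemma Qf_pos (ha : ∀ i, 0 < a i) {n : Fin d → ℤ} (hn : n ≠ 0) : 0 < Qf d a n := by
  obtain ⟨c, hc, h⟩ := exists_mul_norm_sq_le_Qf ha
  have := norm_pos_iff.2 hn
  exact lt_of_lt_of_le (by positivity) (h n)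

lemma summable_Qf_rpow (ha : ∀ i, 0 < a i) {s : ℝ} (hs : (d : ℝ) < s) :
    Summable fun n : {n : Fin d → ℤ // n ≠ 0} ↦ Qf d a n.1 ^ (-(s / 2)) := by
  obtain ⟨c, hc, h⟩ := exists_mul_norm_sq_le_Qf ha
  have hs0 : 0 < s := d.cast_nonneg.trans_lt hs
  refine Summable.of_nonneg_of_le (fun n ↦ Real.rpow_nonneg (Qf_pos ha n.2).le _) (fun n ↦ ?_)
    (((summable_norm_int_rpow hs).mul_left (c ^ (-s))).subtype {n | n ≠ 0})
  have hn := norm_pos_iff.2 n.2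
  calc Qf d a n.1 ^ (-(s / 2)) ≤ ((c * ‖n.1‖) ^ 2) ^ (-(s / 2)) :=
        Real.rpow_le_rpow_of_nonpos (by positivity) (h n.1) (by linarith)
    _ = c ^ (-s) * ‖n.1‖ ^ (-s) := by
        rw [← Real.rpow_natCast, ← Real.rpow_mul (by positivity), ← Real.mul_rpow hc.le hn.le]
        congr 1
        push_cast
        ring

lemma neg_one_zpow_mul_exp_Qf (t : ℝ) (n : Fin d → ℤ) :
    (-1 : ℝ) ^ (∑ i, n i) * Real.exp (-(Qf d a n * t)) =
      ∏ i, altThetaTerm (a i ^ 2 * t) (n i) := by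
  have hz : ∀ S : Finset (Fin d), (-1 : ℝ) ^ (∑ i ∈ S, n i) = ∏ i ∈ S, (-1 : ℝ) ^ n i := by
    intro S
    induction S using Finset.induction_on with
    | empty => simp
    | insert i S hi ih =>
      rw [Finset.sum_insert hi, Finset.prod_insert hi, zpow_add₀ (by norm_num), ih]
  simp only [altThetaTerm]
  rw [Finset.prod_mul_distrib, ← Real.exp_sum, hz, Finset.sum_neg_distrib, Qf, Finset.sum_mul]
  simp only [mul_right_comm]

lemma hasSum_neg_one_zpow_mul_exp_Qf (ha : ∀ i, 0 < a i) {t : ℝ} (ht : 0 < t) :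
    HasSum (fun n : {n : Fin d → ℤ // n ≠ 0} ↦
        (-1 : ℝ) ^ (∑ i, n.1 i) * Real.exp (-(Qf d a n.1 * t)))
      (∏ i, ∑' k, altThetaTerm (a i ^ 2 * t) k - 1) := by
  have hpos (i) : 0 < a i ^ 2 * t := mul_pos (pow_pos (ha i) 2) ht
  have h := (hasSum_pi_prod_of_summable_norm fun i ↦ summable_norm_altThetaTerm (hpos i)).2
  simp only [← neg_one_zpow_mul_exp_Qf] at h
  have hQ0 : Qf d a 0 = 0 := by simp [Qf]
  have h' := (hasSum_unique fun x : ({0} : Set (Fin d → ℤ)) ↦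
    (-1 : ℝ) ^ (∑ i, x.1 i) * Real.exp (-(Qf d a x.1 * t))).hasSum_iff_compl.1 h
  simp only [default_coe_singleton, Pi.zero_apply, Finset.sum_const_zero, zpow_zero, hQ0,
    zero_mul, neg_zero, Real.exp_zero, mul_one] at h'
  exact h'

lemma prod_tsum_altThetaTerm_lt_one (hd : 1 ≤ d) (ha : ∀ i, 0 < a i) {t : ℝ} (ht : 0 < t) :
    ∏ i, ∑' k, altThetaTerm (a i ^ 2 * t) k < 1 := by
  have habs (i) : |∑' k, altThetaTerm (a i ^ 2 * t) k| < 1 :=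
    abs_tsum_altThetaTerm_lt_one (mul_pos (pow_pos (ha i) 2) ht)
  refine (le_abs_self _).trans_lt ?_
  rw [Finset.abs_prod, ← Finset.mul_prod_erase _ _ (Finset.mem_univ (⟨0, hd⟩ : Fin d))]
  exact mul_lt_one_of_nonneg_of_lt_one_left (abs_nonneg _) (habs _)
    (Finset.prod_le_one (fun _ _ ↦ abs_nonneg _) fun i _ ↦ (habs i).le)

end Qf

lemma MeasureTheory.integrable_tsum_of_summable_integral_norm {α ι E : Type*} [MeasurableSpace α]
    {μ : Measure α} [Countable ι] [NormedAddCommGroup E] [CompleteSpace E] {F : ι → α → E}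
    (hF : ∀ i, Integrable (F i) μ) (hsum : Summable fun i ↦ ∫ x, ‖F i x‖ ∂μ)
    {G : α → E} (hG : ∀ᵐ x ∂μ, HasSum (F · x) (G x)) : Integrable G μ := by
  refine ⟨aestronglyMeasurable_of_tendsto_ae atTop
    (f := fun s x ↦ ∑ i ∈ s, F i x)
    (fun s ↦ Finset.aestronglyMeasurable_fun_sum s fun i _ ↦ (hF i).1) hG, ?_⟩
  calc ∫⁻ x, ‖G x‖ₑ ∂μ ≤ ∫⁻ x, ∑' i, ‖F i x‖ₑ ∂μ := by
        refine lintegral_mono_ae (hG.mono fun x hx ↦ ?_)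
        rw [← hx.tsum_eq]
        exact enorm_tsum_le_tsum_enorm
    _ = ∑' i, ∫⁻ x, ‖F i x‖ₑ ∂μ := lintegral_tsum fun i ↦ (hF i).1.enorm
    _ = ∑' i, ENNReal.ofReal (∫ x, ‖F i x‖ ∂μ) := by
        simp_rw [ofReal_integral_norm_eq_lintegral_enorm (hF _)]
    _ < ⊤ := hsum.tsum_ofReal_lt_top

/-- The alternating Epstein zeta function of an orthorhombic lattice is strictly
negative: `Σ_{n≠0} (-1)^{n₁+⋯+n_d} Q_a(n)^{-s/2} < 0` for `s > d`. -/
theorem alternating_epstein_neg_orthorhombic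
    (d : ℕ) (hd : 1 ≤ d) (s : ℝ) (hs : (d : ℝ) < s)
    (a : Fin d → ℝ) (ha : ∀ i, 0 < a i) :
    (∑' n : {n : Fin d → ℤ // n ≠ 0},
        (-1 : ℝ) ^ (∑ i, n.1 i) * (Qf d a n.1) ^ (-(s / 2))) < 0 := by
  have hs2 : 0 < s / 2 := by
    have := d.cast_nonneg.trans_lt hs
    positivity
  have hΓ := Real.Gamma_pos_of_pos hs2
  let F : {n : Fin d → ℤ // n ≠ 0} → ℝ → ℝ := fun n t ↦
    t ^ (s / 2 - 1) * ((-1 : ℝ) ^ (∑ i, n.1 i) * Real.exp (-(Qf d a n.1 * t)))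
  let G : ℝ → ℝ := fun t ↦ t ^ (s / 2 - 1) * (∏ i, ∑' k, altThetaTerm (a i ^ 2 * t) k - 1)
  have hbase (n : {n : Fin d → ℤ // n ≠ 0}) :
      ∫ t in Ioi 0, t ^ (s / 2 - 1) * Real.exp (-(Qf d a n.1 * t)) =
        Qf d a n.1 ^ (-(s / 2)) * Real.Gamma (s / 2) := by
    have hQ := Qf_pos ha n.2
    rw [Real.integral_rpow_mul_exp_neg_mul_Ioi hs2 hQ, one_div, Real.inv_rpow hQ.le,
      Real.rpow_neg hQ.le]
  have hF : ∀ n, IntegrableOn (F n) (Ioi 0) := by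
    intro n
    have := (integrableOn_rpow_mul_exp_neg_mul_rpow (p := 1) (s := s / 2 - 1) (by linarith)
      one_pos (Qf_pos ha n.2)).const_mul ((-1 : ℝ) ^ (∑ i, n.1 i))
    refine this.congr (ae_of_all _ fun t ↦ ?_)
    simp only [F, Real.rpow_one, neg_mul]
    ring
  have hF_integral (n) : ∫ t in Ioi 0, F n t =
      (-1 : ℝ) ^ (∑ i, n.1 i) * Qf d a n.1 ^ (-(s / 2)) * Real.Gamma (s / 2) := by
    simp only [F, mul_left_comm _ ((-1 : ℝ) ^ (∑ i, n.1 i))]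
    rw [integral_const_mul, hbase, mul_assoc]
  have hnorm (n) : ∫ t in Ioi 0, ‖F n t‖ = Qf d a n.1 ^ (-(s / 2)) * Real.Gamma (s / 2) := by
    rw [← hbase]
    refine setIntegral_congr_fun measurableSet_Ioi fun t (ht : 0 < t) ↦ ?_
    simp only [F]
    rw [norm_mul, norm_mul, Real.norm_eq_abs ((-1) ^ _), abs_neg_one_zpow, one_mul,
      Real.norm_of_nonneg (Real.rpow_nonneg ht.le _), Real.norm_of_nonneg (Real.exp_pos _).le]
  have hsum : Summable fun n ↦ ∫ t in Ioi 0, ‖F n t‖ := by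
    simp only [hnorm]
    exact (summable_Qf_rpow ha hs).mul_right _
  have hG : ∀ᵐ t ∂(volume.restrict (Ioi 0)), HasSum (F · t) (G t) :=
    (ae_restrict_mem measurableSet_Ioi).mono fun t ht ↦
      (hasSum_neg_one_zpow_mul_exp_Qf ha ht).mul_left _
  have hGint := integrable_tsum_of_summable_integral_norm hF hsum hG
  have key := (hasSum_integral_of_summable_integral_norm hF hsum).tsum_eq
  rw [integral_congr_ae (hG.mono fun t ht ↦ ht.tsum_eq)] at key
  simp only [hF_integral] at key
  rw [tsum_mul_right] at key
  have hGneg (t : ℝ) (ht : t ∈ Ioi (0 : ℝ)) : 0 < -G t := by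
    rw [← mul_neg]
    exact mul_pos (Real.rpow_pos_of_pos ht _)
      (by linarith [prod_tsum_altThetaTerm_lt_one hd ha ht])
  have hpos : 0 < ∫ t in Ioi 0, -G t := by
    rw [setIntegral_pos_iff_support_of_nonneg_ae
      ((ae_restrict_mem measurableSet_Ioi).mono fun t ht ↦ (hGneg t ht).le) hGint.neg]
    rw [inter_eq_right.2 fun t ht ↦ Function.mem_support.2 (hGneg t ht).ne']
    simp
  rw [integral_neg] at hpos
  exact neg_of_mul_neg_left (by rw [key]; linarith) hΓ.le
end
end
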